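/- arXiv:0807.2028 — 3 statements merged into one kernel-verified Lean document; each statement's English description precedes it below -/
import Mathlib

section
/- Let L > 0 and let (x_t) be a trajectory of the continuous-agent Krause model with x₀ ∈ X_L. Then x_t →_μ F: for every ε > 0 there exists T such that for all t ≥ T there exists s ∈ F with λ({α ∈ [0,1] : |x_t(α) − s(α)| ≥ ε}) < ε. -/
open MeasureTheory

/-- `(x_t)` is a trajectory of the continuous-agent Krause model in `X_L`:
each `x_t` is measurable, maps `[0,1]` into `[0,L]`, and the update rule holds
on `[0,1]` (with the convention that the opinion stays unchanged when the
neighborhood has measure zero). -/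
def IsKrauseTraj (L : ℝ) (x : ℕ → ℝ → ℝ) : Prop :=
  (∀ t, Measurable (x t)) ∧
  (∀ t, ∀ α ∈ Set.Icc (0 : ℝ) 1, x t α ∈ Set.Icc (0 : ℝ) L) ∧
  (∀ t, ∀ α ∈ Set.Icc (0 : ℝ) 1,
    x (t + 1) α =
      if volume {β ∈ Set.Icc (0 : ℝ) 1 | |x t α - x t β| < 1} = 0 then x t α
      else (∫ β in {β ∈ Set.Icc (0 : ℝ) 1 | |x t α - x t β| < 1}, x t β) /
        (volume {β ∈ Set.Icc (0 : ℝ) 1 | |x t α - x t β| < 1}).toReal)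

/-- `F`: measurable functions `[0,1] → [0,L]` whose values on `[0,1]` are
pairwise either equal or at distance at least 1. -/
def Fset (L : ℝ) : Set (ℝ → ℝ) :=
  {s | Measurable s ∧ (∀ α ∈ Set.Icc (0 : ℝ) 1, s α ∈ Set.Icc (0 : ℝ) L) ∧
    ∀ α ∈ Set.Icc (0 : ℝ) 1, ∀ β ∈ Set.Icc (0 : ℝ) 1,
      s α = s β ∨ 1 ≤ |s α - s β|}

/-- Bounded measurable real functions. -/
def BddMeasurable {Ω : Type*} [MeasurableSpace Ω] (f : Ω → ℝ) : Prop :=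
  Measurable f ∧ ∃ C, ∀ ω, |f ω| ≤ C

namespace BddMeasurable

variable {Ω Ω' : Type*} [MeasurableSpace Ω] [MeasurableSpace Ω'] {f g : Ω → ℝ}

lemma const (c : ℝ) : BddMeasurable (fun _ : Ω => c) :=
  ⟨measurable_const, |c|, fun _ => le_rfl⟩

lemma add (hf : BddMeasurable f) (hg : BddMeasurable g) :
    BddMeasurable (fun ω => f ω + g ω) := by
  obtain ⟨hf, C, hC⟩ := hf
  obtain ⟨hg, D, hD⟩ := hg
  exact ⟨hf.add hg, C + D, fun ω => (abs_add_le _ _).trans (add_le_add (hC ω) (hD ω))⟩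

lemma mul (hf : BddMeasurable f) (hg : BddMeasurable g) :
    BddMeasurable (fun ω => f ω * g ω) := by
  obtain ⟨hf, C, hC⟩ := hf
  obtain ⟨hg, D, hD⟩ := hg
  refine ⟨hf.mul hg, C * D, fun ω => ?_⟩
  rw [abs_mul]
  exact mul_le_mul (hC ω) (hD ω) (abs_nonneg _) ((abs_nonneg _).trans (hC ω))

lemma neg (hf : BddMeasurable f) : BddMeasurable (fun ω => -f ω) := by
  simpa using (const (-1)).mul hf

lemma sub (hf : BddMeasurable f) (hg : BddMeasurable g) :
    BddMeasurable (fun ω => f ω - g ω) := by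
  simpa [sub_eq_add_neg] using hf.add hg.neg

lemma sq (hf : BddMeasurable f) : BddMeasurable (fun ω => f ω ^ 2) := by
  simpa [pow_two] using hf.mul hf

lemma abs (hf : BddMeasurable f) : BddMeasurable (fun ω => |f ω|) := by
  obtain ⟨hf, C, hC⟩ := hf
  exact ⟨by fun_prop, C, fun ω => by simpa using hC ω⟩

lemma comp (hf : BddMeasurable f) {φ : Ω' → Ω} (hφ : Measurable φ) :
    BddMeasurable (fun ω => f (φ ω)) :=
  ⟨hf.1.comp hφ, hf.2.imp fun _ h ω => h (φ ω)⟩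

lemma fst (hf : BddMeasurable f) : BddMeasurable (fun p : Ω × Ω' => f p.1) :=
  hf.comp measurable_fst

lemma snd (hf : BddMeasurable f) : BddMeasurable (fun p : Ω' × Ω => f p.2) :=
  hf.comp measurable_snd

lemma indicator {s : Set ℝ} (hs : MeasurableSet s) (hf : Measurable f) :
    BddMeasurable (fun ω => s.indicator (fun _ => (1 : ℝ)) (f ω)) := by
  refine ⟨(measurable_const.indicator hs).comp hf, 1, fun ω => ?_⟩
  by_cases h : f ω ∈ s <;> simp [h]

lemma integrable (hf : BddMeasurable f) (μ : Measure Ω) [IsFiniteMeasure μ] :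
    Integrable f μ := by
  obtain ⟨hf, C, hC⟩ := hf
  exact Integrable.of_bound hf.aestronglyMeasurable C (.of_forall hC)

end BddMeasurable

/-- The interaction kernel: `1` when the opinions are at distance less than `1`, else `0`. -/
noncomputable def near (u v : ℝ) : ℝ := if |u - v| < 1 then 1 else 0

lemma near_comm (u v : ℝ) : near u v = near v u := by
  simp [near, abs_sub_comm]

lemma near_nonneg (u v : ℝ) : 0 ≤ near u v := by
  unfold near; split_ifs <;> norm_num

lemma near_le_one (u v : ℝ) : near u v ≤ 1 := by
  unfold near; split_ifs <;> norm_num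

section Energy

variable {Ω : Type*} [MeasurableSpace Ω] {x δ : Ω → ℝ}

lemma BddMeasurable.near_comp (hx : Measurable x) :
    BddMeasurable (fun p : Ω × Ω => near (x p.1) (x p.2)) := by
  refine ⟨?_, 1, fun p => ?_⟩
  · exact Measurable.ite (measurableSet_lt (by fun_prop) measurable_const)
      measurable_const measurable_const
  · rw [abs_of_nonneg (near_nonneg _ _)]; exact near_le_one _ _

variable {μ : Measure Ω}

/-- `δ` is the displacement produced by one step of the averaging dynamics at `x`. -/
def IsDisplacement (μ : Measure Ω) (x δ : Ω → ℝ) : Prop :=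
  ∀ α, (∫ β, near (x α) (x β) ∂μ) * δ α = ∫ β, near (x α) (x β) * (x β - x α) ∂μ

/-- The energy of an opinion profile. -/
noncomputable def energy (μ : Measure Ω) (x : Ω → ℝ) : ℝ :=
  ∫ p, min 1 ((x p.1 - x p.2) ^ 2) ∂(μ.prod μ)

/-- The total squared disagreement between interacting agents. -/
noncomputable def disagreement (μ : Measure Ω) (x : Ω → ℝ) : ℝ :=
  ∫ p, near (x p.1) (x p.2) * (x p.1 - x p.2) ^ 2 ∂(μ.prod μ)

lemma energy_nonneg (x : Ω → ℝ) : 0 ≤ energy μ x :=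
  integral_nonneg fun _ => le_min zero_le_one (sq_nonneg _)

variable [IsProbabilityMeasure μ]

lemma integral_near_mul_fst (hx : BddMeasurable x) (hδ : BddMeasurable δ)
    (h : IsDisplacement μ x δ) {g : Ω → ℝ} (hg : BddMeasurable g) :
    ∫ p, near (x p.1) (x p.2) * (x p.1 - x p.2) * g p.1 ∂(μ.prod μ) =
      -∫ p, near (x p.1) (x p.2) * δ p.1 * g p.1 ∂(μ.prod μ) := by
  have ha := BddMeasurable.near_comp hx.1
  rw [integral_prod _ (((ha.mul (hx.fst.sub hx.snd)).mul hg.fst).integrable _),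
    integral_prod _ (((ha.mul hδ.fst).mul hg.fst).integrable _), ← integral_neg]
  congr 1
  ext α
  simp only [integral_mul_const]
  rw [h α, ← neg_mul, ← integral_neg]
  congr 2
  ext β
  ring

lemma integral_near_mul_snd (hx : BddMeasurable x) (hδ : BddMeasurable δ)
    (h : IsDisplacement μ x δ) {g : Ω → ℝ} (hg : BddMeasurable g) :
    ∫ p, near (x p.1) (x p.2) * (x p.2 - x p.1) * g p.2 ∂(μ.prod μ) =
      -∫ p, near (x p.1) (x p.2) * δ p.2 * g p.2 ∂(μ.prod μ) := by
  have := integral_near_mul_fst hx hδ h hg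
  rw [← integral_prod_swap, ← integral_prod_swap (f := fun p => _ * δ p.1 * g p.1)] at this
  simpa [near_comm] using this

lemma BddMeasurable.energy_integrand (hx : BddMeasurable x) :
    BddMeasurable (fun p : Ω × Ω => min 1 ((x p.1 - x p.2) ^ 2)) := by
  refine ⟨measurable_const.min (hx.fst.sub hx.snd).sq.1, 1, fun p => ?_⟩
  rw [abs_of_nonneg (le_min zero_le_one (sq_nonneg _))]
  exact min_le_left _ _

lemma near_mul_sq_sub_sq_le (u v u' v' : ℝ) :
    near u v * ((u - v) ^ 2 - (u' - v') ^ 2) ≤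
      min 1 ((u - v) ^ 2) - min 1 ((u' - v') ^ 2) := by
  unfold near
  split_ifs with h
  · have : (u - v) ^ 2 ≤ 1 := (sq_le_one_iff_abs_le_one _).2 h.le
    rw [min_eq_right this]
    linarith [min_le_right 1 ((u' - v') ^ 2)]
  · have : 1 ≤ (u - v) ^ 2 := (one_le_sq_iff_one_le_abs _).2 (not_lt.1 h)
    rw [min_eq_left this]
    linarith [min_le_left 1 ((u' - v') ^ 2)]

lemma integral_near_add_sq_le (hx : BddMeasurable x) (hδ : BddMeasurable δ)
    (h : IsDisplacement μ x δ) :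
    ∫ p, near (x p.1) (x p.2) * (δ p.1 + δ p.2) ^ 2 ∂(μ.prod μ) ≤
      energy μ x - energy μ (fun α => x α + δ α) := by
  have ha := BddMeasurable.near_comp hx.1
  have e1 := integral_near_mul_fst hx hδ h hδ
  have e2 := integral_near_mul_snd hx hδ h hδ
  have b1 := (ha.mul (hx.fst.sub hx.snd)).mul hδ.fst
  have b2 := (ha.mul (hx.snd.sub hx.fst)).mul hδ.snd
  have b3 := (ha.mul hδ.fst).mul hδ.fst
  have b4 := (ha.mul hδ.snd).mul hδ.snd
  have b5 := ha.mul (hδ.fst.add hδ.snd).sq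
  have b13 := (BddMeasurable.const 2).mul (b1.add b3)
  have b24 := (BddMeasurable.const 2).mul (b2.add b4)
  have key : ∫ p, near (x p.1) (x p.2) * (δ p.1 + δ p.2) ^ 2 ∂(μ.prod μ) =
      ∫ p, near (x p.1) (x p.2) *
        ((x p.1 - x p.2) ^ 2 - ((x p.1 + δ p.1) - (x p.2 + δ p.2)) ^ 2) ∂(μ.prod μ) := by
    have : ∀ p : Ω × Ω, near (x p.1) (x p.2) *
        ((x p.1 - x p.2) ^ 2 - ((x p.1 + δ p.1) - (x p.2 + δ p.2)) ^ 2) =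
        near (x p.1) (x p.2) * (δ p.1 + δ p.2) ^ 2
        - 2 * (near (x p.1) (x p.2) * (x p.1 - x p.2) * δ p.1
          + near (x p.1) (x p.2) * δ p.1 * δ p.1)
        - 2 * (near (x p.1) (x p.2) * (x p.2 - x p.1) * δ p.2
          + near (x p.1) (x p.2) * δ p.2 * δ p.2) := fun p => by ring
    simp_rw [this]
    rw [integral_sub ((b5.sub b13).integrable _) (b24.integrable _),
      integral_sub (b5.integrable _) (b13.integrable _), integral_const_mul, integral_const_mul,
      integral_add (b1.integrable _) (b3.integrable _),
      integral_add (b2.integrable _) (b4.integrable _), e1, e2]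
    ring
  rw [key, energy, energy, ← integral_sub (hx.energy_integrand.integrable _)
    ((hx.add hδ).energy_integrand.integrable _)]
  refine integral_mono ?_ ?_ fun p => near_mul_sq_sub_sq_le _ _ _ _
  · exact (ha.mul ((hx.fst.sub hx.snd).sq.sub
      ((hx.add hδ).fst.sub (hx.add hδ).snd).sq)).integrable _
  · exact (hx.energy_integrand.integrable _).sub ((hx.add hδ).energy_integrand.integrable _)

lemma disagreement_le {L : ℝ} (hx : BddMeasurable x) (hL : ∀ α, |x α| ≤ L)
    (hδ : BddMeasurable δ) (h : IsDisplacement μ x δ) :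
    disagreement μ x ≤ 2 * L * ∫ α, |δ α| ∂μ := by
  have ha := BddMeasurable.near_comp hx.1
  have e1 := integral_near_mul_fst hx hδ h hx
  have e2 := integral_near_mul_snd hx hδ h hx
  have i1 := ((ha.mul (hx.fst.sub hx.snd)).mul hx.fst).integrable (μ.prod μ)
  have i2 := ((ha.mul (hx.snd.sub hx.fst)).mul hx.snd).integrable (μ.prod μ)
  have bound : ∀ u v w z : ℝ, |w| ≤ L → -(near u v * z * w) ≤ L * |z| := fun u v w z hw => by
    refine (neg_le_abs _).trans ?_
    rw [abs_mul, abs_mul, abs_of_nonneg (near_nonneg u v), mul_comm L]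
    exact mul_le_mul (mul_le_of_le_one_left (abs_nonneg _) (near_le_one _ _)) hw
      (abs_nonneg _) (abs_nonneg _)
  have b1 : -∫ p, near (x p.1) (x p.2) * δ p.1 * x p.1 ∂(μ.prod μ) ≤ L * ∫ α, |δ α| ∂μ := by
    have := integral_fun_fst (μ := μ) (ν := μ) (fun α => |δ α|)
    simp only [probReal_univ, one_smul] at this
    rw [← integral_neg, ← this, ← integral_const_mul]
    exact integral_mono (((ha.mul hδ.fst).mul hx.fst).neg.integrable _)
      (((BddMeasurable.const L).mul hδ.abs.fst).integrable _) fun p => bound _ _ _ _ (hL _)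
  have b2 : -∫ p, near (x p.1) (x p.2) * δ p.2 * x p.2 ∂(μ.prod μ) ≤ L * ∫ α, |δ α| ∂μ := by
    have := integral_fun_snd (μ := μ) (ν := μ) (fun α => |δ α|)
    simp only [probReal_univ, one_smul] at this
    rw [← integral_neg, ← this, ← integral_const_mul]
    exact integral_mono (((ha.mul hδ.snd).mul hx.snd).neg.integrable _)
      (((BddMeasurable.const L).mul hδ.abs.snd).integrable _) fun p => bound _ _ _ _ (hL _)
  have : disagreement μ x = ∫ p, (near (x p.1) (x p.2) * (x p.1 - x p.2) * x p.1 +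
      near (x p.1) (x p.2) * (x p.2 - x p.1) * x p.2) ∂(μ.prod μ) := by
    unfold disagreement
    congr 1
    ext p
    ring
  rw [this, integral_add i1 i2, e1, e2]
  linarith

lemma sq_integral_abs_le (hδ : BddMeasurable δ) :
    (∫ α, |δ α| ∂μ) ^ 2 ≤ ∫ α, δ α ^ 2 ∂μ := by
  set m := ∫ α, |δ α| ∂μ with hm
  have h0 : 0 ≤ ∫ α, (δ α ^ 2 - (2 * m) * |δ α| + m ^ 2) ∂μ :=
    integral_nonneg fun α => by
      change 0 ≤ δ α ^ 2 - (2 * m) * |δ α| + m ^ 2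
      nlinarith [sq_nonneg (|δ α| - m), sq_abs (δ α)]
  have b2 := (BddMeasurable.const (2 * m)).mul hδ.abs
  rw [integral_add ((hδ.sq.sub b2).integrable μ) (integrable_const _),
    integral_sub (hδ.sq.integrable μ) (b2.integrable μ), integral_const_mul, ← hm] at h0
  simp only [integral_const, probReal_univ, one_smul] at h0
  nlinarith

/-- The opinions lying in `[k / N, (k + 1) / N)` (together with the negative ones if `k = 0`). -/
def bin (N k : ℕ) : Set ℝ := {u | ⌊N * u⌋₊ = k}

lemma measurableSet_bin (N k : ℕ) : MeasurableSet (bin N k) := by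
  have : Measurable fun u : ℝ => ⌊N * u⌋₊ := by fun_prop
  exact this (measurableSet_singleton k)

/-- The indicator function of a bin. -/
noncomputable def binInd (N k : ℕ) (u : ℝ) : ℝ := (bin N k).indicator (fun _ => 1) u

lemma binInd_eq_ite (N k : ℕ) (u : ℝ) : binInd N k u = if ⌊N * u⌋₊ = k then 1 else 0 := by
  simp [binInd, bin, Set.indicator_apply]

lemma binInd_nonneg (N k : ℕ) (u : ℝ) : 0 ≤ binInd N k u := by
  rw [binInd_eq_ite]; split_ifs <;> norm_num

lemma floor_mul_lt {L u : ℝ} (N : ℕ) (hu : u ≤ L) : ⌊N * u⌋₊ < ⌊N * L⌋₊ + 1 :=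
  Nat.lt_succ_of_le (Nat.floor_mono (by gcongr))

lemma sum_binInd {L u : ℝ} (N : ℕ) (hu : u ≤ L) :
    ∑ k ∈ Finset.range (⌊N * L⌋₊ + 1), binInd N k u = 1 := by
  simp [binInd_eq_ite, floor_mul_lt N hu]

lemma sum_binInd_mul_le_near {u v : ℝ} (hu : 0 ≤ u) (hv : 0 ≤ v) (K : ℕ) :
    ∑ k ∈ Finset.range K, binInd 2 k u * binInd 2 k v ≤ near u v := by
  by_cases h : ⌊(2 : ℕ) * u⌋₊ = ⌊(2 : ℕ) * v⌋₊
  · have hn : near u v = 1 := by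
      have h1 := Nat.floor_le (by positivity : (0 : ℝ) ≤ (2 : ℕ) * u)
      have h2 := Nat.lt_floor_add_one ((2 : ℕ) * u : ℝ)
      have h3 := Nat.floor_le (by positivity : (0 : ℝ) ≤ (2 : ℕ) * v)
      have h4 := Nat.lt_floor_add_one ((2 : ℕ) * v : ℝ)
      rw [h] at h1 h2
      push_cast at h1 h2 h3 h4
      exact if_pos (abs_lt.2 ⟨by linarith, by linarith⟩)
    rw [hn]
    simp only [binInd_eq_ite, h, ite_mul, one_mul, zero_mul, Finset.sum_ite_eq]
    split_ifs <;> norm_num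
  · rw [Finset.sum_eq_zero]
    · exact near_nonneg _ _
    · intro k _
      simp only [binInd_eq_ite]
      split_ifs with h1 h2
      · exact absurd (h1.trans h2.symm) h
      all_goals simp

lemma BddMeasurable.binInd_comp (hx : Measurable x) (N k : ℕ) :
    BddMeasurable (fun α => binInd N k (x α)) :=
  .indicator (measurableSet_bin N k) hx

lemma integral_binInd {ν : Measure Ω} (hx : Measurable x) (N k : ℕ) :
    ∫ α, binInd N k (x α) ∂ν = ν.real (x ⁻¹' bin N k) :=
  integral_indicator_one (hx (measurableSet_bin N k))

lemma sq_integral_sq_le {L : ℝ} (hx : BddMeasurable x) (hL : ∀ α, x α ∈ Set.Icc 0 L)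
    (hδ : BddMeasurable δ) (hδL : ∀ α, |δ α| ≤ L) (h : IsDisplacement μ x δ) :
    (∫ α, δ α ^ 2 ∂μ) ^ 2 ≤
      (⌊(2 : ℕ) * L⌋₊ + 1) * L ^ 2 * (energy μ x - energy μ (fun α => x α + δ α)) := by
  set K := ⌊(2 : ℕ) * L⌋₊ + 1 with hK
  set m : ℕ → ℝ := fun k => ∫ α, binInd 2 k (x α) ∂μ
  set q : ℕ → ℝ := fun k => ∫ α, binInd 2 k (x α) * δ α ^ 2 ∂μ
  have hb := fun k => BddMeasurable.binInd_comp hx.1 2 k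
  have hm : ∀ k, 0 ≤ m k := fun k => integral_nonneg fun α => binInd_nonneg _ _ _
  have hq : ∀ k, 0 ≤ q k := fun k =>
    integral_nonneg fun α => mul_nonneg (binInd_nonneg _ _ _) (sq_nonneg _)
  have hqm : ∀ k, q k ≤ L ^ 2 * m k := fun k => by
    rw [← integral_const_mul]
    refine integral_mono (((hb k).mul hδ.sq).integrable _)
      (((BddMeasurable.const _).mul (hb k)).integrable _) fun α => ?_
    change _ * _ ≤ _ * _
    rw [mul_comm]
    exact mul_le_mul_of_nonneg_right (sq_le_sq' (abs_le.1 (hδL α)).1 (abs_le.1 (hδL α)).2)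
      (binInd_nonneg _ _ _)
  have hsum : ∫ α, δ α ^ 2 ∂μ = ∑ k ∈ Finset.range K, q k := by
    rw [← integral_finsetSum _ fun k _ => ((hb k).mul hδ.sq).integrable _]
    simp_rw [← Finset.sum_mul, hK, sum_binInd 2 (hL _).2, one_mul]
  have hblock : ∀ k, 2 * (m k * q k) ≤
      ∫ p, binInd 2 k (x p.1) * binInd 2 k (x p.2) * (δ p.1 + δ p.2) ^ 2 ∂(μ.prod μ) := fun k => by
    have b1 : BddMeasurable fun p : Ω × Ω =>
        (binInd 2 k (x p.1) * δ p.1 ^ 2) * binInd 2 k (x p.2) :=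
      ((hb k).mul hδ.sq).fst.mul (hb k).snd
    have b2 : BddMeasurable fun p : Ω × Ω =>
        binInd 2 k (x p.1) * (binInd 2 k (x p.2) * δ p.2 ^ 2) :=
      (hb k).fst.mul ((hb k).mul hδ.sq).snd
    have b3 : BddMeasurable fun p : Ω × Ω =>
        2 * ((binInd 2 k (x p.1) * δ p.1) * (binInd 2 k (x p.2) * δ p.2)) :=
      (BddMeasurable.const 2).mul (((hb k).mul hδ).fst.mul ((hb k).mul hδ).snd)
    have e : ∀ p : Ω × Ω, binInd 2 k (x p.1) * binInd 2 k (x p.2) * (δ p.1 + δ p.2) ^ 2 =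
        (binInd 2 k (x p.1) * δ p.1 ^ 2) * binInd 2 k (x p.2) +
        binInd 2 k (x p.1) * (binInd 2 k (x p.2) * δ p.2 ^ 2) +
        2 * ((binInd 2 k (x p.1) * δ p.1) * (binInd 2 k (x p.2) * δ p.2)) := fun p => by ring
    simp_rw [e]
    rw [integral_add ((b1.add b2).integrable _) (b3.integrable _),
      integral_add (b1.integrable _) (b2.integrable _), integral_const_mul,
      integral_prod_mul (fun α => binInd 2 k (x α) * δ α ^ 2) (fun α => binInd 2 k (x α)),
      integral_prod_mul (fun α => binInd 2 k (x α)) (fun α => binInd 2 k (x α) * δ α ^ 2),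
      integral_prod_mul (fun α => binInd 2 k (x α) * δ α) (fun α => binInd 2 k (x α) * δ α)]
    change 2 * (m k * q k) ≤ q k * m k + m k * q k + _
    linarith [mul_self_nonneg (∫ α, binInd 2 k (x α) * δ α ∂μ)]
  have hdec : ∑ k ∈ Finset.range K, 2 * (m k * q k) ≤
      energy μ x - energy μ (fun α => x α + δ α) := by
    refine le_trans ?_ (integral_near_add_sq_le hx hδ h)
    refine (Finset.sum_le_sum fun k _ => hblock k).trans ?_
    have bk : ∀ k, BddMeasurable fun p : Ω × Ω =>
        binInd 2 k (x p.1) * binInd 2 k (x p.2) * (δ p.1 + δ p.2) ^ 2 := fun k =>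
      ((hb k).fst.mul (hb k).snd).mul (hδ.fst.add hδ.snd).sq
    rw [← integral_finsetSum _ fun k _ => (bk k).integrable _]
    refine integral_mono (integrable_finsetSum _ fun k _ => (bk k).integrable _)
      (((BddMeasurable.near_comp hx.1).mul (hδ.fst.add hδ.snd).sq).integrable _) fun p => ?_
    change ∑ k ∈ _, _ ≤ _
    rw [← Finset.sum_mul]
    exact mul_le_mul_of_nonneg_right (sum_binInd_mul_le_near (hL _).1 (hL _).1 K) (sq_nonneg _)
  rw [hsum]
  calc (∑ k ∈ Finset.range K, q k) ^ 2
      ≤ K * ∑ k ∈ Finset.range K, q k ^ 2 := by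
        simpa using sq_sum_le_card_mul_sum_sq (s := Finset.range K) (f := q)
    _ ≤ K * (L ^ 2 * ∑ k ∈ Finset.range K, 2 * (m k * q k)) := by
        refine mul_le_mul_of_nonneg_left ?_ (Nat.cast_nonneg K)
        rw [Finset.mul_sum]
        refine Finset.sum_le_sum fun k _ => ?_
        nlinarith [hqm k, hq k, hm k, mul_le_mul_of_nonneg_right (hqm k) (hq k),
          mul_nonneg (sq_nonneg L) (mul_nonneg (hm k) (hq k))]
    _ ≤ K * (L ^ 2 * (energy μ x - energy μ (fun α => x α + δ α))) := by gcongr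
    _ = _ := by rw [hK]; push_cast; ring

/-- Two bins of mass at least `κ` are adjacent or at distance at least `1`
when the disagreement is small. -/
lemma bin_separation {L κ : ℝ} {N : ℕ} (hN : 0 < N) (hκ : 0 < κ) (hx : BddMeasurable x)
    (hL : ∀ α, x α ∈ Set.Icc 0 L) (hD : disagreement μ x < κ ^ 2 / N ^ 2) {i j : ℕ}
    (hi : κ ≤ μ.real (x ⁻¹' bin N i)) (hj : κ ≤ μ.real (x ⁻¹' bin N j)) (hij : i + 2 ≤ j) :
    i + N ≤ j := by
  by_contra! hlt
  refine hD.not_ge ?_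
  have hN' : (0 : ℝ) < N := Nat.cast_pos.2 hN
  have bi := BddMeasurable.binInd_comp hx.1 N i
  have bj := BddMeasurable.binInd_comp hx.1 N j
  calc κ ^ 2 / N ^ 2 ≤ (μ.real (x ⁻¹' bin N i) * μ.real (x ⁻¹' bin N j)) / N ^ 2 := by
        rw [pow_two κ]; gcongr
    _ = ∫ p, binInd N i (x p.1) * binInd N j (x p.2) / N ^ 2 ∂(μ.prod μ) := by
        rw [integral_div, integral_prod_mul (fun α => binInd N i (x α))
          (fun α => binInd N j (x α)), integral_binInd hx.1, integral_binInd hx.1]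
    _ ≤ disagreement μ x := by
        refine integral_mono ((bi.fst.mul bj.snd).integrable _ |>.div_const _)
          (((BddMeasurable.near_comp hx.1).mul (hx.fst.sub hx.snd).sq).integrable _) fun p => ?_
        change binInd N i (x p.1) * binInd N j (x p.2) / N ^ 2 ≤
          near (x p.1) (x p.2) * (x p.1 - x p.2) ^ 2
        have h0 := mul_nonneg (near_nonneg (x p.1) (x p.2)) (sq_nonneg (x p.1 - x p.2))
        rw [binInd_eq_ite, binInd_eq_ite]
        split_ifs with h1 h2
        · have hu := Nat.floor_le (mul_nonneg hN'.le (hL p.1).1)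
          have hu' := Nat.lt_floor_add_one (N * x p.1)
          have hv := Nat.floor_le (mul_nonneg hN'.le (hL p.2).1)
          have hv' := Nat.lt_floor_add_one (N * x p.2)
          rw [h1] at hu hu'
          rw [h2] at hv hv'
          have hij' : (i : ℝ) + 2 ≤ j := by exact_mod_cast hij
          have hlt' : (j : ℝ) + 1 ≤ i + N := by exact_mod_cast hlt
          have near_one : near (x p.1) (x p.2) = 1 := by
            refine if_pos (abs_lt.2 ⟨?_, ?_⟩)
            · nlinarith
            · nlinarith
          rw [near_one, div_le_iff₀ (by positivity)]
          have : 1 ≤ N * x p.2 - N * x p.1 := by linarith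
          nlinarith
        all_goals simpa using h0

lemma exists_separated_representatives {H : ℕ → Prop} {N : ℕ} (hN : 3 ≤ N)
    (hsep : ∀ i j, H i → H j → i + 2 ≤ j → i + N ≤ j) :
    ∃ r : ℕ → ℕ, (∀ i j, r i = r j ∨ r i + N ≤ r j ∨ r j + N ≤ r i) ∧
      (∀ k, H k → r k ≤ k ∧ k ≤ r k + 1) ∧ ∀ k, H (r k) ∨ r k = 0 := by
  classical
  by_cases hne : ∃ k, H k
  · set P : ℕ → Prop := fun k => H k ∧ ∀ i, i + 1 = k → ¬ H i with hP
    have sepP : ∀ i j, P i → P j → i = j ∨ i + N ≤ j ∨ j + N ≤ i := by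
      intro i j hi hj
      rcases lt_trichotomy i j with h | h | h
      · have := hj.2 i
        have := hsep i j hi.1 hj.1
        grind
      · exact .inl h
      · have := hi.2 j
        have := hsep j i hj.1 hi.1
        grind
    have near : ∀ k, H k → ∃ r, P r ∧ r ≤ k ∧ k ≤ r + 1 := by
      intro k hk
      by_cases h : P k
      · exact ⟨k, h, by omega, by omega⟩
      · obtain ⟨i, rfl, hi⟩ : ∃ i, i + 1 = k ∧ H i := by
          simpa [hP, hk] using h
        refine ⟨i, ⟨hi, ?_⟩, by omega, by omega⟩
        rintro l rfl hl
        have := hsep l (l + 1 + 1) hl hk (by omega)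
        omega
    obtain ⟨k₀, hk₀⟩ := hne
    obtain ⟨r₀, hr₀, -⟩ := near k₀ hk₀
    have : ∀ k, ∃ r, P r ∧ (H k → r ≤ k ∧ k ≤ r + 1) := fun k => by
      by_cases hk : H k
      · obtain ⟨r, hr, h⟩ := near k hk
        exact ⟨r, hr, fun _ => h⟩
      · exact ⟨r₀, hr₀, fun h => absurd h hk⟩
    choose r hr using this
    exact ⟨r, fun i j => sepP _ _ (hr i).1 (hr j).1, fun k => (hr k).2, fun k => .inl (hr k).1.1⟩
  · exact ⟨fun _ => 0, fun _ _ => .inl rfl, fun k hk => absurd ⟨k, hk⟩ hne, fun _ => .inr rfl⟩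

lemma exists_quantization {L κ ε : ℝ} {N : ℕ} (hL0 : 0 ≤ L) (hN : 3 ≤ N) (hε : 2 / N ≤ ε)
    (hκ : 0 < κ) (hx : BddMeasurable x) (hL : ∀ α, x α ∈ Set.Icc 0 L)
    (hD : disagreement μ x < κ ^ 2 / N ^ 2) :
    ∃ f : ℝ → ℝ, Measurable f ∧ (∀ u, f u ∈ Set.Icc 0 L) ∧
      (∀ u v, f u = f v ∨ 1 ≤ |f u - f v|) ∧
      μ.real {α | ε ≤ |x α - f (x α)|} ≤ (⌊N * L⌋₊ + 1) * κ := by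
  have hN' : (0 : ℝ) < N := Nat.cast_pos.2 (by omega)
  obtain ⟨r, hrsep, hrk, hrH⟩ := exists_separated_representatives
    (H := fun k => κ ≤ μ.real (x ⁻¹' bin N k)) hN
    fun i j hi hj hij => bin_separation (by omega) hκ hx hL hD hi hj hij
  refine ⟨fun u => r ⌊N * u⌋₊ / N, ?_, fun u => ⟨by positivity, ?_⟩, fun u v => ?_, ?_⟩
  · have h1 : Measurable fun u : ℝ => ⌊N * u⌋₊ := by fun_prop
    exact (measurable_from_top (f := fun k : ℕ => (r k : ℝ) / N)).comp h1
  · beta_reduce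
    generalize ⌊N * u⌋₊ = k
    rw [div_le_iff₀ hN']
    rcases hrH k with h | h
    · obtain ⟨α, hα⟩ : (x ⁻¹' bin N (r k)).Nonempty := by
        by_contra hne
        rw [Set.not_nonempty_iff_eq_empty] at hne
        simp only [hne, measureReal_empty] at h
        linarith
      have hα : ⌊N * x α⌋₊ = r k := hα
      rw [← hα]
      calc (⌊N * x α⌋₊ : ℝ) ≤ N * x α := Nat.floor_le (mul_nonneg hN'.le (hL α).1)
        _ ≤ N * L := by gcongr; exact (hL α).2
        _ = L * N := mul_comm _ _
    · rw [h]; push_cast; positivity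
  · beta_reduce
    generalize ⌊N * u⌋₊ = i
    generalize ⌊N * v⌋₊ = j
    rcases hrsep i j with h | h | h
    · exact .inl (by rw [h])
    · right
      have h' : (r i : ℝ) + N ≤ r j := by exact_mod_cast h
      rw [← sub_div, abs_div, abs_of_pos hN', le_div_iff₀ hN', abs_sub_comm]
      exact (by linarith : 1 * (N : ℝ) ≤ r j - r i).trans (le_abs_self _)
    · right
      have h' : (r j : ℝ) + N ≤ r i := by exact_mod_cast h
      rw [← sub_div, abs_div, abs_of_pos hN', le_div_iff₀ hN']
      exact (by linarith : 1 * (N : ℝ) ≤ r i - r j).trans (le_abs_self _)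
  · classical
    set S := (Finset.range (⌊N * L⌋₊ + 1)).filter fun k => μ.real (x ⁻¹' bin N k) < κ with hS
    have hsub : {α | ε ≤ |x α - r ⌊N * x α⌋₊ / N|} ⊆ ⋃ k ∈ S, x ⁻¹' bin N k := by
      intro α hα
      have hα : ε ≤ |x α - r ⌊N * x α⌋₊ / N| := hα
      simp only [Set.mem_iUnion]
      refine ⟨⌊N * x α⌋₊, ?_, rfl⟩
      rw [hS, Finset.mem_filter, Finset.mem_range]
      refine ⟨floor_mul_lt N (hL α).2, ?_⟩
      by_contra! hheavy
      obtain ⟨h1, h2⟩ := hrk _ hheavy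
      have hu := Nat.floor_le (mul_nonneg hN'.le (hL α).1)
      have hu' := Nat.lt_floor_add_one (N * x α)
      set k := ⌊N * x α⌋₊
      have h1 : (r k : ℝ) ≤ k := by exact_mod_cast h1
      have h2 : (k : ℝ) ≤ r k + 1 := by exact_mod_cast h2
      have : |x α - r k / N| < 2 / N := by
        have e : x α - r k / N = (N * x α - r k) / N := by field_simp
        rw [e, abs_div, abs_of_pos hN', div_lt_div_iff_of_pos_right hN', abs_lt]
        exact ⟨by linarith, by linarith⟩
      linarith
    calc μ.real {α | ε ≤ |x α - r ⌊N * x α⌋₊ / N|}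
        ≤ μ.real (⋃ k ∈ S, x ⁻¹' bin N k) := measureReal_mono hsub (measure_ne_top _ _)
      _ ≤ ∑ k ∈ S, μ.real (x ⁻¹' bin N k) := measureReal_biUnion_finset_le _ _
      _ ≤ ∑ k ∈ S, κ := Finset.sum_le_sum fun k hk => (Finset.mem_filter.1 hk).2.le
      _ = S.card * κ := by simp
      _ ≤ (⌊N * L⌋₊ + 1) * κ := by
        gcongr
        have := Finset.card_filter_le (Finset.range (⌊N * L⌋₊ + 1))
          fun k => μ.real (x ⁻¹' bin N k) < κ
        rw [Finset.card_range] at this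
        exact_mod_cast this

end Energy

section Trajectory

open Filter Topology

variable {Ω : Type*} [MeasurableSpace Ω] {μ : Measure Ω} [IsProbabilityMeasure μ]
  {X : ℕ → Ω → ℝ} {L : ℝ}

lemma tendsto_disagreement (hX : ∀ t, Measurable (X t)) (hL : ∀ t α, X t α ∈ Set.Icc 0 L)
    (h : ∀ t, IsDisplacement μ (X t) (fun α => X (t + 1) α - X t α)) :
    ∀ η > 0, ∃ T, ∀ t ≥ T, disagreement μ (X t) < η := by
  intro η hη
  have habs : ∀ t α, |X t α| ≤ L := fun t α => by
    rw [abs_of_nonneg (hL t α).1]; exact (hL t α).2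
  have hB : ∀ t, BddMeasurable (X t) := fun t => ⟨hX t, L, habs t⟩
  have hδL : ∀ t α, |X (t + 1) α - X t α| ≤ L := fun t α => by
    have h1 := hL t α
    have h2 := hL (t + 1) α
    exact abs_le.2 ⟨by linarith [h1.2, h2.1], by linarith [h1.1, h2.2]⟩
  have hL0 : 0 ≤ L := by
    obtain ⟨α⟩ := nonempty_of_isProbabilityMeasure μ
    exact (hL 0 α).1.trans (hL 0 α).2
  set C : ℝ := (⌊(2 : ℕ) * L⌋₊ + 1) * L ^ 2
  set d : ℕ → ℝ := fun t => energy μ (X t) - energy μ (X (t + 1))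
  have hdec : ∀ t, (∫ α, (X (t + 1) α - X t α) ^ 2 ∂μ) ^ 2 ≤ C * d t := fun t => by
    have := sq_integral_sq_le (hB t) (hL t) ((hB (t + 1)).sub (hB t)) (hδL t) (h t)
    simpa only [add_sub_cancel] using this
  have hd0 : ∀ t, 0 ≤ d t := fun t => by
    have := integral_near_add_sq_le (hB t) ((hB (t + 1)).sub (hB t)) (h t)
    refine le_trans (integral_nonneg fun p => ?_) (by simpa only [add_sub_cancel] using this)
    exact mul_nonneg (near_nonneg _ _) (sq_nonneg _)
  have hanti : Antitone fun t => energy μ (X t) :=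
    antitone_nat_of_succ_le fun t => sub_nonneg.1 (hd0 t)
  have hlim := tendsto_atTop_ciInf hanti ⟨0, by rintro _ ⟨t, rfl⟩; exact energy_nonneg _⟩
  have hd_lim : Tendsto (fun t => (2 * L) ^ 4 * (C * d t)) atTop (𝓝 0) := by
    simpa using ((hlim.sub (hlim.comp (tendsto_add_atTop_nat 1))).const_mul C).const_mul
      ((2 * L) ^ 4)
  obtain ⟨T, hT⟩ := eventually_atTop.1 (hd_lim.eventually_lt_const (pow_pos hη 4))
  refine ⟨T, fun t ht => lt_of_pow_lt_pow_left₀ 4 hη.le (lt_of_le_of_lt ?_ (hT t ht))⟩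
  have h1 := disagreement_le (hB t) (habs t) ((hB (t + 1)).sub (hB t)) (h t)
  have h2 := sq_integral_abs_le (μ := μ) ((hB (t + 1)).sub (hB t))
  have h0 : 0 ≤ disagreement μ (X t) :=
    integral_nonneg fun p => mul_nonneg (near_nonneg _ _) (sq_nonneg _)
  calc disagreement μ (X t) ^ 4
      ≤ (2 * L * ∫ α, |X (t + 1) α - X t α| ∂μ) ^ 4 := by gcongr
    _ = (2 * L) ^ 4 * ((∫ α, |X (t + 1) α - X t α| ∂μ) ^ 2) ^ 2 := by ring
    _ ≤ (2 * L) ^ 4 * (∫ α, (X (t + 1) α - X t α) ^ 2 ∂μ) ^ 2 := by gcongr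
    _ ≤ _ := by gcongr; exact hdec t

end Trajectory

/-- The extension of an opinion profile on `[0,1]` to a function on `ℝ` with the same range. -/
noncomputable def clampExt (x : ℝ → ℝ) (α : ℝ) : ℝ :=
  x (Set.projIcc (0 : ℝ) 1 zero_le_one α)

lemma clampExt_of_mem (x : ℝ → ℝ) {α : ℝ} (hα : α ∈ Set.Icc (0 : ℝ) 1) :
    clampExt x α = x α := by
  rw [clampExt, Set.projIcc_of_mem _ hα]

lemma isDisplacement_clampExt {L : ℝ} {x : ℕ → ℝ → ℝ} (h : IsKrauseTraj L x) (t : ℕ) :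
    IsDisplacement (volume.restrict (Set.Icc (0 : ℝ) 1)) (clampExt (x t))
      (fun α => clampExt (x (t + 1)) α - clampExt (x t) α) := by
  obtain ⟨hmeas, hrange, hstep⟩ := h
  intro α
  set a : ℝ := ↑(Set.projIcc (0 : ℝ) 1 zero_le_one α)
  have ha_mem : a ∈ Set.Icc (0 : ℝ) 1 := Subtype.coe_prop _
  change (∫ β in Set.Icc 0 1, near (x t a) (clampExt (x t) β)) * (x (t + 1) a - x t a) =
    ∫ β in Set.Icc 0 1, near (x t a) (clampExt (x t) β) * (clampExt (x t) β - x t a)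
  set U : Set ℝ := {β | |x t a - x t β| < 1} with hU
  have hUm : MeasurableSet U := measurableSet_lt (by have := hmeas t; fun_prop) measurable_const
  have hset : {β ∈ Set.Icc (0 : ℝ) 1 | |x t a - x t β| < 1} = Set.Icc 0 1 ∩ U := rfl
  have hconv : ∀ g : ℝ → ℝ,
      ∫ β in Set.Icc 0 1, near (x t a) (clampExt (x t) β) * g (clampExt (x t) β) =
        ∫ β in Set.Icc 0 1 ∩ U, g (x t β) := fun g => by
    rw [← setIntegral_indicator hUm]
    refine setIntegral_congr_fun measurableSet_Icc fun β hβ => ?_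
    simp only [clampExt_of_mem _ hβ, near, Set.indicator_apply, hU, Set.mem_ofPred_eq]
    split_ifs <;> simp
  have h1 := hconv fun _ => 1
  have h2 := hconv fun u => u - x t a
  simp only [mul_one] at h1
  rw [h1, h2]
  have hfin : volume (Set.Icc (0 : ℝ) 1 ∩ U) ≠ ⊤ :=
    measure_ne_top_of_subset Set.inter_subset_left (by simp)
  have hint : IntegrableOn (x t) (Set.Icc 0 1 ∩ U) := by
    refine Measure.integrableOn_of_bounded (M := L) hfin (hmeas t).aestronglyMeasurable ?_
    refine (ae_restrict_iff' (measurableSet_Icc.inter hUm)).2 (.of_forall fun β hβ => ?_)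
    rw [Real.norm_eq_abs, abs_of_nonneg (hrange t β hβ.1).1]
    exact (hrange t β hβ.1).2
  have hconst : IntegrableOn (fun _ => x t a) (Set.Icc 0 1 ∩ U) := integrableOn_const hfin
  rw [integral_sub hint hconst, hstep t a ha_mem, hset]
  simp only [setIntegral_const, smul_eq_mul, mul_one, Measure.real]
  split_ifs with h0
  · simp [h0, Measure.restrict_eq_zero.2 h0]
  · have : (volume (Set.Icc (0 : ℝ) 1 ∩ U)).toReal ≠ 0 := ENNReal.toReal_ne_zero.2 ⟨h0, hfin⟩
    field_simp

/-- Along any trajectory of the continuous-agent Krause model,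
`x_t →_μ F`. -/
theorem krause_continuum_tendsto_F (L : ℝ) (hL : 0 < L) (x : ℕ → ℝ → ℝ)
    (htraj : IsKrauseTraj L x) :
    ∀ ε > (0 : ℝ), ∃ T : ℕ, ∀ t ≥ T, ∃ s ∈ Fset L,
      volume {α ∈ Set.Icc (0 : ℝ) 1 | ε ≤ |x t α - s α|} <
        ENNReal.ofReal ε := by
  intro ε hε
  obtain ⟨N₀, hN₀⟩ := exists_nat_gt (2 / ε)
  set N := N₀ + 3
  have hN : 2 / (N : ℝ) ≤ ε := by
    have : 2 / ε ≤ N := hN₀.le.trans (by exact_mod_cast Nat.le_add_right N₀ 3)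
    rw [div_le_iff₀ (by positivity)]
    rwa [div_le_iff₀ hε, mul_comm] at this
  set κ := ε / (2 * (⌊N * L⌋₊ + 1)) with hκ
  have hκ0 : 0 < κ := by positivity
  set μ := (volume : Measure ℝ).restrict (Set.Icc 0 1) with hμ
  have : IsProbabilityMeasure μ := ⟨by simp [hμ]⟩
  have hX : ∀ t, Measurable (clampExt (x t)) := fun t =>
    (htraj.1 t).comp (continuous_subtype_val.comp continuous_projIcc).measurable
  have hXL : ∀ t α, clampExt (x t) α ∈ Set.Icc 0 L := fun t α =>
    htraj.2.1 t _ (Subtype.coe_prop _)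
  obtain ⟨T, hT⟩ := tendsto_disagreement (μ := μ) hX hXL (isDisplacement_clampExt htraj)
    (κ ^ 2 / N ^ 2) (by positivity)
  refine ⟨T, fun t ht => ?_⟩
  have hB : BddMeasurable (clampExt (x t)) :=
    ⟨hX t, L, fun α => by rw [abs_of_nonneg (hXL t α).1]; exact (hXL t α).2⟩
  obtain ⟨f, hf, hfL, hfsep, hfμ⟩ :=
    exists_quantization hL.le (by omega) hN hκ0 hB (hXL t) (hT t ht)
  refine ⟨fun α => f (x t α), ⟨hf.comp (htraj.1 t), fun α _ => hfL _, fun α _ β _ => hfsep _ _⟩,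
    ?_⟩
  have hset : volume {α ∈ Set.Icc (0 : ℝ) 1 | ε ≤ |x t α - f (x t α)|} =
      μ {α | ε ≤ |clampExt (x t) α - f (clampExt (x t) α)|} := by
    rw [hμ, Measure.restrict_apply' measurableSet_Icc]
    congr 1
    ext α
    simp only [Set.mem_ofPred_eq, Set.mem_inter_iff]
    rw [and_comm]
    exact and_congr_left fun hα => by rw [clampExt_of_mem _ hα]
  rw [hset, ← ofReal_measureReal, ENNReal.ofReal_lt_ofReal_iff hε]
  refine hfμ.trans_lt ?_
  have : (⌊N * L⌋₊ + 1 : ℝ) * κ = ε / 2 := by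
    rw [hκ]; field_simp
  linarith
end

section
/- Let L > 0 and let (x_t) be a trajectory of the continuous-agent Krause model such that x₀ is regular and sup_α x_t(α) − inf_α x_t(α) > 2 for every t ≥ 0. Suppose that (x_t) converges in the μ-sense to some function in X_L. Then there exists s ∈ F with x_t →_μ s, and for any two distinct values a, b taken by s with μ_s({a}) > 0 and μ_s({b}) > 0, one has |b − a| ≥ 1 + min(μ_s({a}), μ_s({b})) / max(μ_s({a}), μ_s({b})). In particular, if μ_s({a}) = μ_s({b}) then |b − a| ≥ 2. -/
open MeasureTheory

/-- `μ_s({a})`: the measure of the set of agents whose opinion is `a`. -/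
noncomputable def muPoint (s : ℝ → ℝ) (a : ℝ) : ℝ :=
  (volume {α ∈ Set.Icc (0 : ℝ) 1 | s α = a}).toReal

/-- A regular opinion function: the density of agents on every subinterval of
`[inf x, sup x]` (extrema over `[0,1]`) is bounded above and below by positive
constants `M ≥ m > 0`. -/
def RegularOpinion (x : ℝ → ℝ) : Prop :=
  ∃ m M : ℝ, 0 < m ∧ m ≤ M ∧ ∀ a b : ℝ,
    sInf (x '' Set.Icc (0 : ℝ) 1) ≤ a → a ≤ b →
    b ≤ sSup (x '' Set.Icc (0 : ℝ) 1) →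
    m * (b - a) ≤ (volume {α ∈ Set.Icc (0 : ℝ) 1 | x α ∈ Set.Icc a b}).toReal ∧
    (volume {α ∈ Set.Icc (0 : ℝ) 1 | x α ∈ Set.Icc a b}).toReal ≤ M * (b - a)

/-- Convergence in the `μ`-sense: `x_t →_μ y`. -/
def TendstoMu (x : ℕ → ℝ → ℝ) (y : ℝ → ℝ) : Prop :=
  ∀ ε > (0 : ℝ), ∃ T : ℕ, ∀ t ≥ T,
    volume {α ∈ Set.Icc (0 : ℝ) 1 | ε ≤ |x t α - y α|} < ENNReal.ofReal ε

/-- The mean of `ν` over the open window of radius one around `v`. -/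
noncomputable def windowMean (ν : Measure ℝ) (v : ℝ) : ℝ :=
  (∫ u in Set.Ioo (v - 1) (v + 1), u ∂ν) / ν.real (Set.Ioo (v - 1) (v + 1))

/-- Every nondegenerate open subinterval of `[p, q]` is charged by `ν`. -/
def ChargesIntervals (ν : Measure ℝ) (p q : ℝ) : Prop :=
  ∀ c d : ℝ, p ≤ c → c < d → d ≤ q → 0 < ν (Set.Ioo c d)

lemma Continuous.integrableOn_Ioo_of_isFiniteMeasure {ν : Measure ℝ} [IsFiniteMeasure ν]
    {f : ℝ → ℝ} (hf : Continuous f) (a b : ℝ) : IntegrableOn f (Set.Ioo a b) ν :=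
  hf.integrableOn_Icc.mono_set Set.Ioo_subset_Icc_self

lemma setIntegral_window_sub_const {ν : Measure ℝ} [IsFiniteMeasure ν] {v : ℝ}
    (hv : 0 < ν (Set.Ioo (v - 1) (v + 1))) (c : ℝ) :
    ∫ u in Set.Ioo (v - 1) (v + 1), (u - c) ∂ν =
      (windowMean ν v - c) * ν.real (Set.Ioo (v - 1) (v + 1)) := by
  have hpos : 0 < ν.real (Set.Ioo (v - 1) (v + 1)) :=
    ENNReal.toReal_pos hv.ne' (measure_ne_top _ _)
  rw [integral_sub (continuous_id'.integrableOn_Ioo_of_isFiniteMeasure _ _)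
    (continuous_const.integrableOn_Ioo_of_isFiniteMeasure _ _), setIntegral_const, windowMean]
  simp only [smul_eq_mul]
  field_simp

lemma setIntegral_Ioo_pos {ν : Measure ℝ} [IsFiniteMeasure ν] {a b : ℝ} {f : ℝ → ℝ}
    (hν : 0 < ν (Set.Ioo a b)) (hf : Continuous f) (hpos : ∀ u ∈ Set.Ioo a b, 0 < f u) :
    0 < ∫ u in Set.Ioo a b, f u ∂ν := by
  rw [setIntegral_pos_iff_support_of_nonneg_ae]
  · refine hν.trans_le (measure_mono fun u hu => ⟨(hpos u hu).ne', hu⟩)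
  · filter_upwards [ae_restrict_mem measurableSet_Ioo] with u hu using (hpos u hu).le
  · exact hf.integrableOn_Ioo_of_isFiniteMeasure _ _

lemma windowMean_mem_Ioo {ν : Measure ℝ} [IsFiniteMeasure ν] {v : ℝ}
    (hv : 0 < ν (Set.Ioo (v - 1) (v + 1))) : windowMean ν v ∈ Set.Ioo (v - 1) (v + 1) := by
  have hpos : 0 < ν.real (Set.Ioo (v - 1) (v + 1)) :=
    ENNReal.toReal_pos hv.ne' (measure_ne_top _ _)
  constructor
  · have h := setIntegral_Ioo_pos hv (f := fun u => u - (v - 1)) (by fun_prop)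
      (fun u hu => sub_pos.2 hu.1)
    rw [setIntegral_window_sub_const hv] at h
    linarith [pos_of_mul_pos_left h hpos.le]
  · have h := setIntegral_Ioo_pos hv (f := fun u => -(u - (v + 1))) (by fun_prop)
      (fun u hu => by linarith [hu.2])
    rw [integral_neg, setIntegral_window_sub_const hv, ← neg_mul] at h
    linarith [pos_of_mul_pos_left h hpos.le]

lemma ChargesIntervals.window_pos {ν : Measure ℝ} {p q v : ℝ} (h : ChargesIntervals ν p q)
    (hpq : p < q) (hv : v ∈ Set.Icc p q) : 0 < ν (Set.Ioo (v - 1) (v + 1)) := by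
  refine (h (max p (v - 1)) (min q (v + 1)) (le_max_left _ _) ?_ (min_le_left _ _)).trans_le
    (measure_mono (Set.Ioo_subset_Ioo (le_max_right _ _) (min_le_right _ _)))
  rw [max_lt_iff, lt_min_iff, lt_min_iff]
  exact ⟨⟨hpq, by linarith [hv.1]⟩, by linarith [hv.2], by linarith⟩

lemma strictMonoOn_windowMean {ν : Measure ℝ} [IsFiniteMeasure ν] {p q : ℝ}
    (h : ChargesIntervals ν p q) (hpq : p + 2 < q) :
    StrictMonoOn (windowMean ν) (Set.Icc p q) := by
  intro v hv w hw hvw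
  have hνv := h.window_pos (by linarith) hv
  have hνw := h.window_pos (by linarith) hw
  obtain ⟨hz₁, hz₂⟩ := windowMean_mem_Ioo hνv
  obtain ⟨hy₁, -⟩ := windowMean_mem_Ioo hνw
  set z := windowMean ν v with hz
  rcases lt_or_ge z (w - 1) with hlt | hge
  · linarith
  have hw_pos : 0 < ν.real (Set.Ioo (w - 1) (w + 1)) :=
    ENNReal.toReal_pos hνw.ne' (measure_ne_top _ _)
  have h_integral : ∀ a : ℝ, Integrable
      ((Set.Ioo (a - 1) (a + 1)).indicator (fun u => u - z)) ν := fun a =>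
    (Continuous.integrableOn_Ioo_of_isFiniteMeasure (by fun_prop) _ _).integrable_indicator
      measurableSet_Ioo
  have key : 0 < ∫ u, ((Set.Ioo (w - 1) (w + 1)).indicator (fun u => u - z) u -
      (Set.Ioo (v - 1) (v + 1)).indicator (fun u => u - z) u) ∂ν := by
    refine (integral_pos_iff_support_of_nonneg_ae ?_ ((h_integral w).sub (h_integral v))).2 ?_
    rotate_left
    · rcases lt_or_ge (v + 1) q with hq | hq
      · refine (h (v + 1) (min (w + 1) q) (by linarith [hv.1])
          (lt_min (by linarith) hq) (min_le_right _ _)).trans_le (measure_mono fun u hu => ?_)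
        have hu2 := lt_min_iff.1 hu.2
        have h1 : u ∈ Set.Ioo (w - 1) (w + 1) := ⟨by linarith [hu.1], hu2.1⟩
        have h2 : u ∉ Set.Ioo (v - 1) (v + 1) := fun h' => by linarith [hu.1, h'.2]
        simp only [Function.mem_support, Pi.sub_apply, Set.indicator_of_mem h1, Set.indicator_of_notMem h2]
        have := hu.1
        exact ne_of_gt (by linarith)
      · refine (h (v - 1) (w - 1) (by linarith) (by linarith)
          (by linarith [hw.2])).trans_le (measure_mono fun u hu => ?_)
        have h1 : u ∉ Set.Ioo (w - 1) (w + 1) := fun h' => by linarith [hu.2, h'.1]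
        have h2 : u ∈ Set.Ioo (v - 1) (v + 1) := ⟨hu.1, by linarith [hu.2]⟩
        simp only [Function.mem_support, Pi.sub_apply, Set.indicator_of_notMem h1, Set.indicator_of_mem h2]
        have := hu.2
        exact ne_of_gt (by linarith)
    · refine Filter.Eventually.of_forall fun u => ?_
      by_cases h1 : u ∈ Set.Ioo (w - 1) (w + 1) <;> by_cases h2 : u ∈ Set.Ioo (v - 1) (v + 1)
      · simp [Set.indicator_of_mem h1, Set.indicator_of_mem h2]
      · simp only [Pi.zero_apply, Pi.sub_apply, Set.indicator_of_mem h1, Set.indicator_of_notMem h2]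
        have : v + 1 ≤ u := by
          by_contra! h3
          exact h2 ⟨by linarith [h1.1], h3⟩
        linarith
      · simp only [Pi.zero_apply, Pi.sub_apply, Set.indicator_of_notMem h1, Set.indicator_of_mem h2]
        have : u ≤ w - 1 := by
          by_contra! h3
          exact h1 ⟨h3, by linarith [h2.2]⟩
        linarith
      · simp [Set.indicator_of_notMem h1, Set.indicator_of_notMem h2]
  rw [integral_sub (h_integral w) (h_integral v), integral_indicator measurableSet_Ioo,
    integral_indicator measurableSet_Ioo, setIntegral_window_sub_const hνw,
    setIntegral_window_sub_const hνv, ← hz, sub_self, zero_mul, sub_zero] at key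
  linarith [pos_of_mul_pos_left key hw_pos.le]

lemma continuous_setIntegral_window {ν : Measure ℝ} [IsFiniteMeasure ν] [NullSingletonClass ν]
    {f : ℝ → ℝ} (hf : Continuous f) :
    Continuous fun v => ∫ u in Set.Ioo (v - 1) (v + 1), f u ∂ν := by
  rw [continuous_iff_continuousAt]
  intro v₀
  simp_rw [← integral_indicator measurableSet_Ioo]
  refine continuousAt_of_dominated
    (bound := (Set.Icc (v₀ - 2) (v₀ + 2)).indicator fun u => ‖f u‖) ?_ ?_ ?_ ?_
  · exact Filter.Eventually.of_forall fun v =>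
      (hf.measurable.indicator measurableSet_Ioo).aestronglyMeasurable
  · filter_upwards [Ioo_mem_nhds (show v₀ - 1 < v₀ by linarith) (show v₀ < v₀ + 1 by linarith)]
      with v hv
    refine Filter.Eventually.of_forall fun u => ?_
    rw [norm_indicator_eq_indicator_norm]
    refine Set.indicator_le_indicator_of_subset (fun u hu => ?_) (fun _ => norm_nonneg _) u
    exact ⟨by linarith [hu.1, hv.1], by linarith [hu.2, hv.2]⟩
  · exact (hf.norm.integrableOn_Icc).integrable_indicator measurableSet_Icc
  · have h1 : ∀ᵐ u ∂ν, u ≠ v₀ - 1 := by simp [ae_iff]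
    have h2 : ∀ᵐ u ∂ν, u ≠ v₀ + 1 := by simp [ae_iff]
    filter_upwards [h1, h2] with u hu1 hu2
    by_cases hu : u ∈ Set.Ioo (v₀ - 1) (v₀ + 1)
    · refine (continuousAt_const (y := f u)).congr ?_
      filter_upwards [Ioo_mem_nhds (show u - 1 < v₀ by linarith [hu.2])
        (show v₀ < u + 1 by linarith [hu.1])] with v hv
      rw [Set.indicator_of_mem]
      exact ⟨by linarith [hv.2], by linarith [hv.1]⟩
    · refine (continuousAt_const (y := (0 : ℝ))).congr ?_
      have : u < v₀ - 1 ∨ v₀ + 1 < u := by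
        rcases lt_or_gt_of_ne hu1 with h | h
        · exact Or.inl h
        · exact Or.inr (lt_of_le_of_ne (not_lt.1 fun h' => hu ⟨h, h'⟩) hu2.symm)
      rcases this with h | h
      · filter_upwards [lt_mem_nhds (show u + 1 < v₀ by linarith)] with v hv
        rw [Set.indicator_of_notMem]
        exact fun h' => by linarith [h'.1]
      · filter_upwards [gt_mem_nhds (show v₀ < u - 1 by linarith)] with v hv
        rw [Set.indicator_of_notMem]
        exact fun h' => by linarith [h'.2]

lemma continuousOn_windowMean {ν : Measure ℝ} [IsFiniteMeasure ν] [NullSingletonClass ν] {p q : ℝ}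
    (h : ChargesIntervals ν p q) (hpq : p < q) :
    ContinuousOn (windowMean ν) (Set.Icc p q) := by
  have hden : Continuous fun v => ν.real (Set.Ioo (v - 1) (v + 1)) := by
    simpa using continuous_setIntegral_window (ν := ν) (f := fun _ => 1) continuous_const
  refine (continuous_setIntegral_window continuous_id).continuousOn.div hden.continuousOn ?_
  exact fun v hv => (ENNReal.toReal_pos (h.window_pos hpq hv).ne' (measure_ne_top _ _)).ne'

/-- Lebesgue measure on the set `[0,1]` of agents. -/
noncomputable abbrev agentMeasure : Measure ℝ := volume.restrict (Set.Icc (0 : ℝ) 1)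

instance : IsProbabilityMeasure agentMeasure := ⟨by simp [agentMeasure]⟩

lemma volume_sep_Icc (p : ℝ → Prop) :
    volume {α ∈ Set.Icc (0 : ℝ) 1 | p α} = agentMeasure {α | p α} := by
  rw [Measure.restrict_apply' measurableSet_Icc, Set.inter_comm]
  rfl

lemma ae_agentMeasure {p : ℝ → Prop} (h : ∀ α ∈ Set.Icc (0 : ℝ) 1, p α) :
    ∀ᵐ α ∂agentMeasure, p α := by
  filter_upwards [ae_restrict_mem measurableSet_Icc] with α hα using h α hα

/-- The distribution of the opinions `f` over the agents. -/
noncomputable abbrev opinionLaw (f : ℝ → ℝ) : Measure ℝ := agentMeasure.map f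

lemma abs_sub_lt_one_iff_mem_window (v u : ℝ) :
    |v - u| < 1 ↔ u ∈ Set.Ioo (v - 1) (v + 1) := by
  rw [abs_sub_comm, abs_lt]
  constructor <;> rintro ⟨h1, h2⟩ <;> constructor <;> linarith

lemma IsKrauseTraj.eq_windowMean {L : ℝ} {x : ℕ → ℝ → ℝ} (hx : IsKrauseTraj L x) (t : ℕ)
    {α : ℝ} (hα : α ∈ Set.Icc (0 : ℝ) 1)
    (hpos : 0 < opinionLaw (x t) (Set.Ioo (x t α - 1) (x t α + 1))) :
    x (t + 1) α = windowMean (opinionLaw (x t)) (x t α) := by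
  have hm := hx.1 t
  have hset : {β ∈ Set.Icc (0 : ℝ) 1 | |x t α - x t β| < 1} =
      x t ⁻¹' Set.Ioo (x t α - 1) (x t α + 1) ∩ Set.Icc 0 1 := by
    ext β
    simp only [Set.mem_ofPred_eq, abs_sub_lt_one_iff_mem_window, Set.mem_inter_iff,
      Set.mem_preimage]
    tauto
  have hpre : MeasurableSet (x t ⁻¹' Set.Ioo (x t α - 1) (x t α + 1)) := hm measurableSet_Ioo
  have hvol : volume (x t ⁻¹' Set.Ioo (x t α - 1) (x t α + 1) ∩ Set.Icc 0 1) =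
      opinionLaw (x t) (Set.Ioo (x t α - 1) (x t α + 1)) := by
    rw [opinionLaw, Measure.map_apply hm measurableSet_Ioo, Measure.restrict_apply hpre]
  rw [hx.2.2 t α hα, hset, hvol, if_neg hpos.ne', windowMean, measureReal_def, opinionLaw,
    setIntegral_map measurableSet_Ioo (by fun_prop) hm.aemeasurable,
    Measure.restrict_restrict hpre]

lemma sInf_image_le {L : ℝ} {f : ℝ → ℝ} (hf : ∀ α ∈ Set.Icc (0 : ℝ) 1, f α ∈ Set.Icc 0 L)
    {α : ℝ} (hα : α ∈ Set.Icc (0 : ℝ) 1) : sInf (f '' Set.Icc 0 1) ≤ f α :=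
  csInf_le ⟨0, by rintro _ ⟨β, hβ, rfl⟩; exact (hf β hβ).1⟩ ⟨α, hα, rfl⟩

lemma le_sSup_image {L : ℝ} {f : ℝ → ℝ} (hf : ∀ α ∈ Set.Icc (0 : ℝ) 1, f α ∈ Set.Icc 0 L)
    {α : ℝ} (hα : α ∈ Set.Icc (0 : ℝ) 1) : f α ≤ sSup (f '' Set.Icc 0 1) :=
  le_csSup ⟨L, by rintro _ ⟨β, hβ, rfl⟩; exact (hf β hβ).2⟩ ⟨α, hα, rfl⟩

/-- The distribution of opinions has no atoms and charges every interval between the extreme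
opinions. -/
def DiffuseOpinion (f : ℝ → ℝ) : Prop :=
  (∀ v, agentMeasure {α | f α = v} = 0) ∧
    ChargesIntervals (opinionLaw f) (sInf (f '' Set.Icc 0 1)) (sSup (f '' Set.Icc 0 1))

lemma DiffuseOpinion.nullSingletonClass {f : ℝ → ℝ} (hf : Measurable f) (h : DiffuseOpinion f) :
    NullSingletonClass (opinionLaw f) := by
  refine ⟨fun v => ?_⟩
  rw [opinionLaw, Measure.map_apply hf (measurableSet_singleton v)]
  exact h.1 v

lemma RegularOpinion.diffuseOpinion {L : ℝ} {f : ℝ → ℝ} (hfm : Measurable f)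
    (hf : ∀ α ∈ Set.Icc (0 : ℝ) 1, f α ∈ Set.Icc 0 L) (h : RegularOpinion f) :
    DiffuseOpinion f := by
  obtain ⟨m, M, hm, -, H⟩ := h
  constructor
  · intro v
    rw [← volume_sep_Icc]
    by_cases hv : ∃ α ∈ Set.Icc (0 : ℝ) 1, f α = v
    · obtain ⟨α, hα, rfl⟩ := hv
      have := (H (f α) (f α) (sInf_image_le hf hα) le_rfl (le_sSup_image hf hα)).2
      rw [sub_self, mul_zero] at this
      have h0 := le_antisymm this ENNReal.toReal_nonneg
      rw [volume_sep_Icc] at h0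
      have h0' := ((ENNReal.toReal_eq_zero_iff _).1 h0).resolve_right (measure_ne_top _ _)
      simp only [Set.Icc_self, Set.mem_singleton_iff] at h0'
      rw [volume_sep_Icc]
      exact h0'
    · convert measure_empty (μ := volume)
      ext α
      simp only [Set.mem_ofPred_eq, Set.mem_empty_iff_false, iff_false]
      exact fun h' => hv ⟨α, h'.1, h'.2⟩
  · intro c d hc hcd hd
    have h1 := (H ((2 * c + d) / 3) ((c + 2 * d) / 3) (by linarith) (by linarith)
      (by linarith)).1
    have h2 : 0 < m * ((c + 2 * d) / 3 - (2 * c + d) / 3) := mul_pos hm (by linarith)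
    have h3 := (ENNReal.toReal_pos_iff.1 (h2.trans_le h1)).1
    rw [volume_sep_Icc] at h3
    rw [opinionLaw, Measure.map_apply hfm measurableSet_Ioo]
    exact h3.trans_le (measure_mono fun α hα => ⟨by linarith [hα.1], by linarith [hα.2]⟩)

lemma IsKrauseTraj.diffuseOpinion_succ {L : ℝ} {x : ℕ → ℝ → ℝ} (hx : IsKrauseTraj L x) (t : ℕ)
    (hspread : 2 < sSup (x t '' Set.Icc (0 : ℝ) 1) - sInf (x t '' Set.Icc (0 : ℝ) 1))
    (h : DiffuseOpinion (x t)) : DiffuseOpinion (x (t + 1)) := by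
  have hm := hx.1 t
  have := h.nullSingletonClass hm
  have hb := hx.2.1 t
  have hb' := hx.2.1 (t + 1)
  set p := sInf (x t '' Set.Icc (0 : ℝ) 1) with hp
  set q := sSup (x t '' Set.Icc (0 : ℝ) 1) with hq
  have hc : ChargesIntervals (opinionLaw (x t)) p q := h.2
  have hmem : ∀ α ∈ Set.Icc (0 : ℝ) 1, x t α ∈ Set.Icc p q := fun α hα =>
    ⟨sInf_image_le hb hα, le_sSup_image hb hα⟩
  have hstep : ∀ α ∈ Set.Icc (0 : ℝ) 1,
      x (t + 1) α = windowMean (opinionLaw (x t)) (x t α) := fun α hα =>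
    hx.eq_windowMean t hα (hc.window_pos (by linarith) (hmem α hα))
  have hmono := strictMonoOn_windowMean hc (by linarith)
  have hcont := continuousOn_windowMean hc (by linarith)
  constructor
  · intro v
    by_cases hv : ∃ β ∈ Set.Icc (0 : ℝ) 1, x (t + 1) β = v
    · obtain ⟨β, hβ, rfl⟩ := hv
      refine measure_mono_null_ae ?_ (h.1 (x t β))
      filter_upwards [ae_restrict_mem measurableSet_Icc] with α hα hαβ
      have h1 : x (t + 1) α = x (t + 1) β := hαβ
      rw [hstep α hα, hstep β hβ] at h1
      exact hmono.injOn (hmem α hα) (hmem β hβ) h1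
    · rw [← volume_sep_Icc]
      convert measure_empty (μ := volume)
      ext α
      simp only [Set.mem_ofPred_eq, Set.mem_empty_iff_false, iff_false]
      exact fun h' => hv ⟨α, h'.1, h'.2⟩
  · intro c d hcp hcd hdq
    have hne : (x (t + 1) '' Set.Icc (0 : ℝ) 1).Nonempty := ⟨_, 0, by simp, rfl⟩
    obtain ⟨_, ⟨α₁, hα₁, rfl⟩, h1⟩ := exists_lt_of_csInf_lt hne
      (show sInf (x (t + 1) '' Set.Icc (0 : ℝ) 1) < (c + d) / 2 by linarith)
    obtain ⟨_, ⟨α₂, hα₂, rfl⟩, h2⟩ := exists_lt_of_lt_csSup hne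
      (show (c + d) / 2 < sSup (x (t + 1) '' Set.Icc (0 : ℝ) 1) by linarith)
    rw [hstep α₁ hα₁] at h1
    rw [hstep α₂ hα₂] at h2
    have hlt : x t α₁ < x t α₂ :=
      (hmono.lt_iff_lt (hmem α₁ hα₁) (hmem α₂ hα₂)).1 (h1.trans h2)
    have hsub : Set.Icc (x t α₁) (x t α₂) ⊆ Set.Icc p q :=
      Set.Icc_subset_Icc (hmem α₁ hα₁).1 (hmem α₂ hα₂).2
    obtain ⟨v, hv, hve⟩ := intermediate_value_Ioo hlt.le (hcont.mono hsub) ⟨h1, h2⟩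
    have hv_nhds : Set.Icc p q ∈ nhds v :=
      Filter.mem_of_superset (Ioo_mem_nhds hv.1 hv.2) (Set.Ioo_subset_Icc_self.trans hsub)
    have hnhds : {w | windowMean (opinionLaw (x t)) w ∈ Set.Ioo c d} ∩
        Set.Ioo (x t α₁) (x t α₂) ∈ nhds v := by
      refine Filter.inter_mem (hcont.continuousAt hv_nhds ?_) (Ioo_mem_nhds hv.1 hv.2)
      rw [hve]
      exact Ioo_mem_nhds (by linarith) (by linarith)
    obtain ⟨l, u, ⟨hl, hu⟩, hlu⟩ := mem_nhds_iff_exists_Ioo_subset.1 hnhds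
    have hlu_le : Set.Ioo l u ⊆ Set.Ioo (x t α₁) (x t α₂) := fun w hw => (hlu hw).2
    obtain ⟨hl', hu'⟩ := (Set.Ioo_subset_Ioo_iff (hl.trans hu)).1 hlu_le
    have hpos := hc l u ((hmem α₁ hα₁).1.trans hl') (hl.trans hu) (hu'.trans (hmem α₂ hα₂).2)
    rw [opinionLaw, Measure.map_apply hm measurableSet_Ioo] at hpos
    rw [opinionLaw, Measure.map_apply (hx.1 (t + 1)) measurableSet_Ioo]
    refine hpos.trans_le (measure_mono_ae ?_)
    filter_upwards [ae_restrict_mem measurableSet_Icc] with α hα hαlu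
    have := (hlu hαlu).1
    rwa [Set.mem_ofPred_eq, ← hstep α hα] at this

lemma IsKrauseTraj.diffuseOpinion {L : ℝ} {x : ℕ → ℝ → ℝ} (hx : IsKrauseTraj L x)
    (hreg : RegularOpinion (x 0))
    (hspread : ∀ t : ℕ,
      2 < sSup (x t '' Set.Icc (0 : ℝ) 1) - sInf (x t '' Set.Icc (0 : ℝ) 1)) (t : ℕ) :
    DiffuseOpinion (x t) := by
  induction t with
  | zero => exact hreg.diffuseOpinion (hx.1 0) (hx.2.1 0)
  | succ t ih => exact hx.diffuseOpinion_succ t (hspread t) ih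

lemma TendstoMu.tendstoInMeasure {x : ℕ → ℝ → ℝ} {y : ℝ → ℝ} (h : TendstoMu x y) :
    TendstoInMeasure agentMeasure x Filter.atTop y := by
  rw [tendstoInMeasure_iff_dist]
  intro ε hε
  rw [ENNReal.tendsto_atTop_zero]
  intro δ hδ
  obtain ⟨r, hr0, hr⟩ : ∃ r : ℝ, 0 < r ∧ ENNReal.ofReal r ≤ δ := by
    rcases eq_or_ne δ ⊤ with rfl | hδ'
    · exact ⟨1, one_pos, le_top⟩
    · exact ⟨δ.toReal, ENNReal.toReal_pos hδ.ne' hδ', ENNReal.ofReal_toReal_le⟩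
  obtain ⟨T, hT⟩ := h (min ε r) (lt_min hε hr0)
  refine ⟨T, fun t ht => ?_⟩
  have := hT t ht
  rw [volume_sep_Icc] at this
  refine (measure_mono fun α hα => ?_).trans (this.le.trans
    ((ENNReal.ofReal_le_ofReal (min_le_right _ _)).trans hr))
  have h1 : ε ≤ dist (x t α) (y α) := hα
  exact (min_le_left _ _).trans h1

lemma TendstoMu.congr_ae {x : ℕ → ℝ → ℝ} {y z : ℝ → ℝ} (h : TendstoMu x y)
    (hyz : y =ᵐ[agentMeasure] z) : TendstoMu x z := by
  intro ε hε
  obtain ⟨T, hT⟩ := h ε hε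
  refine ⟨T, fun t ht => ?_⟩
  have := hT t ht
  rw [volume_sep_Icc] at this ⊢
  refine (measure_mono_ae ?_).trans_lt this
  filter_upwards [hyz] with α hα h'
  have h1 : ε ≤ |x t α - z α| := h'
  rw [← hα] at h1
  exact h1

/-- The difference of two opinions when they interact, and zero otherwise. -/
noncomputable def interaction (d : ℝ) : ℝ := (Set.Ioo (-1 : ℝ) 1).indicator id d

lemma measurable_interaction : Measurable interaction :=
  measurable_id.indicator measurableSet_Ioo

lemma interaction_neg (d : ℝ) : interaction (-d) = -interaction d := by
  by_cases h : d ∈ Set.Ioo (-1 : ℝ) 1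
  · have h' : -d ∈ Set.Ioo (-1 : ℝ) 1 := ⟨by linarith [h.2], by linarith [h.1]⟩
    simp [interaction, Set.indicator_of_mem h, Set.indicator_of_mem h']
  · have h' : -d ∉ Set.Ioo (-1 : ℝ) 1 := fun h' => h ⟨by linarith [h'.2], by linarith [h'.1]⟩
    simp [interaction, Set.indicator_of_notMem h, Set.indicator_of_notMem h']

lemma abs_interaction_le (d : ℝ) : |interaction d| ≤ 1 := by
  by_cases h : d ∈ Set.Ioo (-1 : ℝ) 1
  · simpa [interaction, Set.indicator_of_mem h] using abs_le.2 ⟨h.1.le, h.2.le⟩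
  · simp [interaction, Set.indicator_of_notMem h]

/-- A continuous lower bound for the interaction energy, vanishing exactly where the interaction
does. -/
noncomputable def bump (d : ℝ) : ℝ := d ^ 2 * max 0 (1 - |d|)

lemma continuous_bump : Continuous bump := by unfold bump; fun_prop

lemma bump_nonneg (d : ℝ) : 0 ≤ bump d := mul_nonneg (sq_nonneg d) (le_max_left _ _)

lemma bump_le_interaction_mul (d : ℝ) : bump d ≤ interaction d * d := by
  by_cases h : d ∈ Set.Ioo (-1 : ℝ) 1
  · simp only [bump, interaction, Set.indicator_of_mem h, id]
    have : max 0 (1 - |d|) ≤ 1 := max_le zero_le_one (by linarith [abs_nonneg d])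
    nlinarith [sq_nonneg d]
  · have h' : 1 ≤ |d| := by
      by_contra! h'
      exact h (abs_lt.1 h')
    simp [bump, interaction, Set.indicator_of_notMem h, max_eq_left (sub_nonpos.2 h')]

lemma bump_le_one (d : ℝ) : bump d ≤ 1 := by
  refine (bump_le_interaction_mul d).trans ?_
  by_cases h : d ∈ Set.Ioo (-1 : ℝ) 1
  · simp only [interaction, Set.indicator_of_mem h, id]
    nlinarith [h.1, h.2]
  · simp [interaction, Set.indicator_of_notMem h]

lemma eq_zero_or_one_le_abs_of_bump_eq_zero {d : ℝ} (h : bump d = 0) : d = 0 ∨ 1 ≤ |d| := by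
  rcases mul_eq_zero.1 h with h | h
  · exact Or.inl (pow_eq_zero_iff two_ne_zero |>.1 h)
  · right
    have := le_max_right 0 (1 - |d|)
    linarith

lemma IsKrauseTraj.abs_integral_interaction_le {L : ℝ} {x : ℕ → ℝ → ℝ}
    (hx : IsKrauseTraj L x) (t : ℕ) {α : ℝ} (hα : α ∈ Set.Icc (0 : ℝ) 1) :
    |∫ β, interaction (x t α - x t β) ∂agentMeasure| ≤ |x t α - x (t + 1) α| := by
  have hm := hx.1 t
  set S := {β | |x t α - x t β| < 1} with hS
  have hSm : MeasurableSet S :=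
    measurableSet_lt (by fun_prop) measurable_const
  have hset : {β ∈ Set.Icc (0 : ℝ) 1 | |x t α - x t β| < 1} = S ∩ Set.Icc 0 1 := by
    rw [Set.inter_comm]; rfl
  have h_integral : (fun β => interaction (x t α - x t β)) =
      S.indicator fun β => x t α - x t β := by
    ext β
    by_cases h : β ∈ S
    · rw [Set.indicator_of_mem h, interaction, 
        Set.indicator_of_mem (Set.mem_Ioo.2 (abs_lt.1 h)), id]
    · rw [Set.indicator_of_notMem h, interaction,
        Set.indicator_of_notMem fun h' => h (show _ < _ from abs_lt.2 (Set.mem_Ioo.1 h'))]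
  have hupd := hx.2.2 t α hα
  rw [hset, ← Measure.restrict_restrict hSm, ← Measure.restrict_apply hSm] at hupd
  have hxint : IntegrableOn (x t) S agentMeasure := by
    refine Integrable.integrableOn (Integrable.of_bound hm.aestronglyMeasurable L ?_)
    refine ae_agentMeasure fun β hβ => ?_
    have := hx.2.1 t β hβ
    rw [Real.norm_eq_abs, abs_of_nonneg this.1]
    exact this.2
  rw [h_integral, integral_indicator hSm, integral_sub (integrable_const _) hxint, setIntegral_const,
    smul_eq_mul]
  by_cases h0 : agentMeasure S = 0
  · rw [Measure.restrict_eq_zero.2 h0, integral_zero_measure, measureReal_def, h0]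
    simp
  · rw [if_neg h0, ← measureReal_def] at hupd
    have hpos : 0 < agentMeasure.real S :=
      ENNReal.toReal_pos h0 (measure_ne_top _ _)
    have hle : agentMeasure.real S ≤ 1 := measureReal_le_one
    have : agentMeasure.real S * x t α - ∫ β in S, x t β ∂agentMeasure =
        agentMeasure.real S * (x t α - x (t + 1) α) := by
      rw [hupd]
      field_simp
    rw [this, abs_mul, abs_of_pos hpos]
    exact mul_le_of_le_one_left (abs_nonneg _) hle

lemma integrable_prod_of_abs_le {f : ℝ × ℝ → ℝ} (hf : Measurable f) (C : ℝ)
    (h : ∀ α ∈ Set.Icc (0 : ℝ) 1, ∀ β ∈ Set.Icc (0 : ℝ) 1, |f (α, β)| ≤ C) :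
    Integrable f (agentMeasure.prod agentMeasure) := by
  refine Integrable.of_bound hf.aestronglyMeasurable C ?_
  filter_upwards [Measure.quasiMeasurePreserving_fst.ae (ae_restrict_mem measurableSet_Icc),
    Measure.quasiMeasurePreserving_snd.ae (ae_restrict_mem measurableSet_Icc)] with z h1 h2
  exact h z.1 h1 z.2 h2

lemma IsKrauseTraj.integral_bump_le {L : ℝ} {x : ℕ → ℝ → ℝ} (hx : IsKrauseTraj L x) (t : ℕ) :
    ∫ z, bump (x t z.1 - x t z.2) ∂(agentMeasure.prod agentMeasure) ≤
      2 * ∫ α, L * |x t α - x (t + 1) α| ∂agentMeasure := by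
  have hm := hx.1 t
  have hb := hx.2.1 t
  have hL : 0 ≤ L := (hb 0 (by simp)).1.trans (hb 0 (by simp)).2
  have habs : ∀ s, ∀ α ∈ Set.Icc (0 : ℝ) 1, |x s α| ≤ L := fun s α hα => by
    rw [abs_of_nonneg (hx.2.1 s α hα).1]
    exact (hx.2.1 s α hα).2
  have hkm : Measurable fun z : ℝ × ℝ => interaction (x t z.1 - x t z.2) :=
    measurable_interaction.comp (by fun_prop)
  have hI₁ : Integrable (fun z : ℝ × ℝ => interaction (x t z.1 - x t z.2) * x t z.1)
      (agentMeasure.prod agentMeasure) := by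
    refine integrable_prod_of_abs_le (hkm.mul (by fun_prop)) (1 * L) fun α hα β hβ => ?_
    rw [abs_mul]
    exact mul_le_mul (abs_interaction_le _) (habs t α hα) (abs_nonneg _) zero_le_one
  have hI₂ : Integrable (fun z : ℝ × ℝ => interaction (x t z.1 - x t z.2) * x t z.2)
      (agentMeasure.prod agentMeasure) := by
    refine integrable_prod_of_abs_le (hkm.mul (by fun_prop)) (1 * L) fun α hα β hβ => ?_
    rw [abs_mul]
    exact mul_le_mul (abs_interaction_le _) (habs t β hβ) (abs_nonneg _) zero_le_one
  have hswap : ∫ z : ℝ × ℝ, interaction (x t z.1 - x t z.2) * x t z.2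
        ∂(agentMeasure.prod agentMeasure) =
      -∫ z : ℝ × ℝ, interaction (x t z.1 - x t z.2) * x t z.1
        ∂(agentMeasure.prod agentMeasure) := by
    rw [← integral_prod_swap, ← integral_neg]
    refine integral_congr_ae (Filter.Eventually.of_forall fun z => ?_)
    simp only [Prod.fst_swap, Prod.snd_swap]
    rw [← neg_sub (x t z.1), interaction_neg, neg_mul]
  calc ∫ z, bump (x t z.1 - x t z.2) ∂(agentMeasure.prod agentMeasure)
      ≤ ∫ z : ℝ × ℝ, (interaction (x t z.1 - x t z.2) * x t z.1 -
          interaction (x t z.1 - x t z.2) * x t z.2) ∂(agentMeasure.prod agentMeasure) := by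
        refine integral_mono (integrable_prod_of_abs_le
          (continuous_bump.measurable.comp (by fun_prop)) 1 fun α _ β _ => ?_)
          (hI₁.sub hI₂) fun z => ?_
        · rw [abs_of_nonneg (bump_nonneg _)]
          exact bump_le_one _
        · simp only [← mul_sub]
          exact bump_le_interaction_mul _
    _ = 2 * ∫ α, (∫ β, interaction (x t α - x t β) ∂agentMeasure) * x t α ∂agentMeasure := by
        rw [integral_sub hI₁ hI₂, hswap, integral_prod _ hI₁]
        simp only [integral_mul_const]
        ring
    _ ≤ 2 * ∫ α, L * |x t α - x (t + 1) α| ∂agentMeasure := by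
        refine mul_le_mul_of_nonneg_left (integral_mono_ae ?_ ?_ ?_) zero_le_two
        · simpa only [integral_mul_const] using hI₁.integral_prod_left
        · refine Integrable.of_bound (C := L * (L + L)) ?_ ?_
          · have := hx.1 (t + 1)
            exact Measurable.aestronglyMeasurable (by fun_prop)
          · refine ae_agentMeasure fun α hα => ?_
            rw [Real.norm_eq_abs, abs_mul, abs_of_nonneg hL, abs_abs]
            exact mul_le_mul_of_nonneg_left ((abs_sub _ _).trans
              (add_le_add (habs t α hα) (habs (t + 1) α hα))) hL
        · refine ae_agentMeasure fun α hα => (le_abs_self _).trans ?_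
          rw [abs_mul, mul_comm]
          exact mul_le_mul (habs t α hα) (hx.abs_integral_interaction_le t hα) (abs_nonneg _) hL

lemma IsKrauseTraj.ae_separated {L : ℝ} {x : ℕ → ℝ → ℝ} (hx : IsKrauseTraj L x)
    {y : ℝ → ℝ} (hy : Measurable y) (hxy : TendstoMu x y) :
    ∀ᵐ z ∂(agentMeasure.prod agentMeasure), y z.1 = y z.2 ∨ 1 ≤ |y z.1 - y z.2| := by
  have hL : 0 ≤ L := (hx.2.1 0 0 (by simp)).1.trans (hx.2.1 0 0 (by simp)).2
  have habs : ∀ s, ∀ α ∈ Set.Icc (0 : ℝ) 1, |x s α| ≤ L := fun s α hα => by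
    rw [abs_of_nonneg (hx.2.1 s α hα).1]
    exact (hx.2.1 s α hα).2
  have hmeas := hx.1
  obtain ⟨n, hn, hn_ae⟩ := hxy.tendstoInMeasure.exists_seq_tendsto_ae
  have hsucc : TendstoInMeasure agentMeasure (fun k => x (n k + 1)) Filter.atTop y :=
    fun ε hε => (hxy.tendstoInMeasure ε hε).comp
      ((Filter.tendsto_add_atTop_nat 1).comp hn.tendsto_atTop)
  obtain ⟨k, hk, hk_ae⟩ := hsucc.exists_seq_tendsto_ae
  have hn_ae' : ∀ᵐ α ∂agentMeasure,
      Filter.Tendsto (fun i => x (n (k i)) α) Filter.atTop (nhds (y α)) := by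
    filter_upwards [hn_ae] with α hα using hα.comp hk.tendsto_atTop
  have hrhs : Filter.Tendsto
      (fun i => 2 * ∫ α, L * |x (n (k i)) α - x (n (k i) + 1) α| ∂agentMeasure)
      Filter.atTop (nhds 0) := by
    have h := tendsto_integral_of_dominated_convergence (μ := agentMeasure)
      (F := fun i α => L * |x (n (k i)) α - x (n (k i) + 1) α|) (f := fun _ => 0)
      (fun _ => L * (L + L)) (fun i => ?_) (integrable_const _) (fun i => ?_) ?_
    · simpa using h.const_mul 2
    · exact Measurable.aestronglyMeasurable (by fun_prop)
    · refine ae_agentMeasure fun α hα => ?_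
      rw [Real.norm_eq_abs, abs_mul, abs_of_nonneg hL, abs_abs]
      exact mul_le_mul_of_nonneg_left ((abs_sub _ _).trans
        (add_le_add (habs _ α hα) (habs _ α hα))) hL
    · filter_upwards [hn_ae', hk_ae] with α h1 h2
      simpa using ((h1.sub h2).abs).const_mul L
  have hbm : ∀ f : ℝ → ℝ, Measurable f → Measurable fun z : ℝ × ℝ => bump (f z.1 - f z.2) :=
    fun f hf => continuous_bump.measurable.comp (by fun_prop)
  have hlhs : Filter.Tendsto
      (fun i => ∫ z, bump (x (n (k i)) z.1 - x (n (k i)) z.2)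
        ∂(agentMeasure.prod agentMeasure))
      Filter.atTop (nhds (∫ z, bump (y z.1 - y z.2) ∂(agentMeasure.prod agentMeasure))) := by
    refine tendsto_integral_of_dominated_convergence (fun _ => 1)
      (fun i => (hbm _ (hmeas _)).aestronglyMeasurable) (integrable_const _) (fun i => ?_) ?_
    · refine Filter.Eventually.of_forall fun z => ?_
      rw [Real.norm_eq_abs, abs_of_nonneg (bump_nonneg _)]
      exact bump_le_one _
    · filter_upwards [Measure.quasiMeasurePreserving_fst.ae hn_ae',
        Measure.quasiMeasurePreserving_snd.ae hn_ae'] with z h1 h2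
      exact (continuous_bump.tendsto _).comp (h1.sub h2)
  have hle := le_of_tendsto_of_tendsto' hlhs hrhs fun i => hx.integral_bump_le _
  have hzero := le_antisymm hle (integral_nonneg fun z => bump_nonneg _)
  have h_integral : Integrable (fun z : ℝ × ℝ => bump (y z.1 - y z.2))
      (agentMeasure.prod agentMeasure) :=
    integrable_prod_of_abs_le (hbm y hy) 1 fun α _ β _ => by
      rw [abs_of_nonneg (bump_nonneg _)]
      exact bump_le_one _
  filter_upwards [(integral_eq_zero_iff_of_nonneg (fun z => bump_nonneg _) h_integral).1 hzero]
    with z hz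
  exact (eq_zero_or_one_le_abs_of_bump_eq_zero hz).imp_left sub_eq_zero.1

/-- A bounded function with almost surely separated values agrees almost everywhere with a
function in `Fset`. -/
lemma exists_mem_Fset_ae_eq {L : ℝ} {y : ℝ → ℝ} (hy : Measurable y)
    (hb : ∀ α ∈ Set.Icc (0 : ℝ) 1, y α ∈ Set.Icc 0 L)
    (hsep : ∀ᵐ z ∂(agentMeasure.prod agentMeasure), y z.1 = y z.2 ∨ 1 ≤ |y z.1 - y z.2|) :
    ∃ s ∈ Fset L, y =ᵐ[agentMeasure] s := by
  have hgood : ∀ᵐ α ∂agentMeasure, α ∈ Set.Icc (0 : ℝ) 1 ∧ y α ∈ (opinionLaw y).support ∧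
      ∀ᵐ β ∂agentMeasure, y α = y β ∨ 1 ≤ |y α - y β| := by
    have h1 : ∀ᵐ α ∂agentMeasure, y α ∈ (opinionLaw y).support :=
      ae_of_ae_map hy.aemeasurable Measure.support_mem_ae
    filter_upwards [ae_restrict_mem measurableSet_Icc, h1, Measure.ae_ae_of_ae_prod hsep]
      with α h h' h'' using ⟨h, h', h''⟩
  set G := {α | α ∈ Set.Icc (0 : ℝ) 1 ∧ y α ∈ (opinionLaw y).support ∧
      ∀ᵐ β ∂agentMeasure, y α = y β ∨ 1 ≤ |y α - y β|} with hG
  have hsepG : ∀ α ∈ G, ∀ β ∈ G, y α = y β ∨ 1 ≤ |y α - y β| := by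
    rintro α ⟨-, -, hα⟩ β ⟨-, hβ, -⟩
    by_contra! hcon
    obtain ⟨hne, hlt⟩ := hcon
    have hopen : IsOpen (Metric.ball (y α) 1 \ {y α}) :=
      Metric.isOpen_ball.sdiff isClosed_singleton
    have hmem : y β ∈ Metric.ball (y α) 1 \ {y α} := by
      refine ⟨?_, fun h => hne h.symm⟩
      rwa [Metric.mem_ball, dist_comm]
    have hpos := (Measure.mem_support_iff_forall _).1 hβ _ (hopen.mem_nhds hmem)
    rw [opinionLaw, Measure.map_apply hy hopen.measurableSet] at hpos
    refine hpos.ne' (measure_mono_null (fun γ hγ => ?_) (ae_iff.1 hα))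
    rintro (h | h)
    · exact hγ.2 h.symm
    · have h' := Metric.mem_ball.1 hγ.1
      rw [dist_comm] at h'
      exact absurd h' (not_lt.2 h)
  obtain ⟨α₀, hα₀⟩ := hgood.exists
  set N := toMeasurable agentMeasure Gᶜ with hN
  have hN0 : agentMeasure N = 0 := by
    rw [hN, measure_toMeasurable]
    exact hgood
  have hNG : ∀ α, α ∉ N → α ∈ G := fun α hα => by
    by_contra h
    exact hα (subset_toMeasurable _ _ h)
  classical
  have hval : ∀ α, ∃ β ∈ G, N.piecewise (fun _ => y α₀) y α = y β := fun α => by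
    by_cases h : α ∈ N
    · exact ⟨α₀, hα₀, Set.piecewise_eq_of_mem _ _ _ h⟩
    · exact ⟨α, hNG α h, Set.piecewise_eq_of_notMem _ _ _ h⟩
  refine ⟨N.piecewise (fun _ => y α₀) y, ⟨?_, ?_, ?_⟩, ?_⟩
  · exact measurable_const.piecewise (measurableSet_toMeasurable _ _) hy
  · intro α _
    obtain ⟨β, hβ, h⟩ := hval α
    rw [h]
    exact hb β hβ.1
  · intro α _ β _
    obtain ⟨α', hα', h1⟩ := hval α
    obtain ⟨β', hβ', h2⟩ := hval β
    rw [h1, h2]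
    exact hsepG α' hα' β' hβ'
  · filter_upwards [measure_eq_zero_iff_ae_notMem.1 hN0] with α hα
    rw [Set.piecewise_eq_of_notMem _ _ _ hα]

lemma muPoint_eq (s : ℝ → ℝ) (a : ℝ) : muPoint s a = agentMeasure.real {α | s α = a} := by
  rw [muPoint, volume_sep_Icc, measureReal_def]

/-- Agents close to the centre of mass `m` of two clusters `a < b` of `s` that are both strictly
within distance one of `m` stay close to `m`, as long as the opinions are close to `s`. -/
lemma IsKrauseTraj.abs_succ_sub_le {L : ℝ} {x : ℕ → ℝ → ℝ} (hx : IsKrauseTraj L x)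
    {s : ℝ → ℝ} (hs : s ∈ Fset L) {a b m δ η : ℝ}
    (ha : ∃ α ∈ Set.Icc (0 : ℝ) 1, s α = a) (hb : ∃ α ∈ Set.Icc (0 : ℝ) 1, s α = b)
    (hδ : 0 < δ) (ham : a + 2 * δ < m) (hmb : m + 2 * δ < b)
    (hma : m - a + 2 * δ < 1) (hbm : b - m + 2 * δ < 1)
    (hcenter : muPoint s a * (a - m) + muPoint s b * (b - m) = 0)
    (hηδ : η ≤ δ) (hηW : 2 * η < muPoint s a + muPoint s b)
    (hηδW : 8 * η ≤ δ * (muPoint s a + muPoint s b)) {t : ℕ}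
    (hclose : agentMeasure {β | η ≤ |x t β - s β|} < ENNReal.ofReal η)
    {α : ℝ} (hα : α ∈ Set.Icc (0 : ℝ) 1) (hαm : |x t α - m| ≤ δ) :
    |x (t + 1) α - m| ≤ δ := by
  obtain ⟨αa, hαa, rfl⟩ := ha
  obtain ⟨αb, hαb, rfl⟩ := hb
  set a := s αa
  set b := s αb
  have hm := hx.1 t
  have hsm := hs.1
  set v := x t α with hv
  obtain ⟨hvm₁, hvm₂⟩ := abs_le.1 hαm
  set S := {β | |v - x t β| < 1} with hS
  set A := {β | s β = a} with hA
  set B := {β | s β = b} with hB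
  set E := {β | η ≤ |x t β - s β|} with hE
  have hSm : MeasurableSet S := measurableSet_lt (by fun_prop) measurable_const
  have hAm : MeasurableSet A := hsm (measurableSet_singleton a)
  have hBm : MeasurableSet B := hsm (measurableSet_singleton b)
  have hEm : MeasurableSet E := measurableSet_le measurable_const (by fun_prop)
  rw [muPoint_eq, muPoint_eq] at hcenter hηW hηδW
  have hη : 0 < η := by
    by_contra! h
    rw [ENNReal.ofReal_of_nonpos h] at hclose
    exact not_lt_zero hclose
  have hE_le : agentMeasure.real E ≤ η :=
    ENNReal.toReal_le_of_le_ofReal hη.le hclose.le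
  have hAB : Disjoint A B := by
    rw [Set.disjoint_left]
    intro β h1 h2
    have h1' : s β = a := h1
    have h2' : s β = b := h2
    linarith
  have hS_of_mem : ∀ β, β ∉ E → β ∈ A ∪ B → β ∈ S := by
    intro β hβ hβAB
    have h1 := abs_lt.1 (show |x t β - s β| < η from not_le.1 fun h => hβ h)
    refine show |v - x t β| < 1 from abs_lt.2 ?_
    rcases hβAB with h | h
    · have h' : s β = a := h
      constructor <;> linarith [h1.1, h1.2]
    · have h' : s β = b := h
      constructor <;> linarith [h1.1, h1.2]
  have hS_of_notMem : ∀ β ∈ Set.Icc (0 : ℝ) 1, β ∉ E → β ∉ A ∪ B → β ∉ S := by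
    intro β hβI hβ hβAB hβS
    have h1 := abs_lt.1 (show |x t β - s β| < η from not_le.1 fun h => hβ h)
    have h2 := abs_lt.1 (show |v - x t β| < 1 from hβS)
    have h3 := (hs.2.2 β hβI αa hαa).resolve_left fun h => hβAB (Or.inl h)
    have h4 := (hs.2.2 β hβI αb hαb).resolve_left fun h => hβAB (Or.inr h)
    rcases le_abs.1 h3 with h3 | h3 <;> rcases le_abs.1 h4 with h4 | h4 <;>
      linarith [h1.1, h1.2, h2.1, h2.2]
  have hdeg : agentMeasure.real A + agentMeasure.real B - η ≤ agentMeasure.real S := by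
    have h1 : agentMeasure.real (A ∪ B) ≤ agentMeasure.real (S ∪ E) := by
      refine measureReal_mono fun β hβ => ?_
      by_cases h : β ∈ E
      · exact Or.inr h
      · exact Or.inl (hS_of_mem β h hβ)
    rw [measureReal_union hAB hBm] at h1
    linarith [measureReal_union_le (μ := agentMeasure) S E]
  have hdeg_pos : 0 < agentMeasure.real S := by linarith
  have hxt : Integrable (x t) agentMeasure := by
    refine Integrable.of_bound hm.aestronglyMeasurable L ?_
    refine ae_agentMeasure fun β hβ => ?_
    have := hx.2.1 t β hβ
    rw [Real.norm_eq_abs, abs_of_nonneg this.1]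
    exact this.2
  have hxint : Integrable (fun β => x t β - m) agentMeasure := hxt.sub (integrable_const m)
  have hupd : x (t + 1) α - m = (∫ β in S, (x t β - m) ∂agentMeasure) / agentMeasure.real S := by
    have hset : {β ∈ Set.Icc (0 : ℝ) 1 | |x t α - x t β| < 1} = S ∩ Set.Icc 0 1 := by
      rw [Set.inter_comm]; rfl
    have hupd := hx.2.2 t α hα
    have h0 : agentMeasure S ≠ 0 := fun h => by simp [measureReal_def, h] at hdeg_pos
    rw [hset, ← Measure.restrict_restrict hSm, ← Measure.restrict_apply hSm, if_neg h0,
      ← measureReal_def] at hupd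
    rw [integral_sub hxt.integrableOn (integrable_const _), setIntegral_const, smul_eq_mul,
      hupd]
    field_simp
  set g : ℝ → ℝ := fun β => A.indicator (fun _ => a - m) β + B.indicator (fun _ => b - m) β
    with hg
  have hgint₁ : Integrable (A.indicator fun _ => a - m) agentMeasure :=
    (integrable_const _).indicator hAm
  have hgint₂ : Integrable (B.indicator fun _ => b - m) agentMeasure :=
    (integrable_const _).indicator hBm
  have hgint : Integrable g agentMeasure := hgint₁.add hgint₂
  have hg0 : ∫ β, g β ∂agentMeasure = 0 := by
    rw [hg, integral_add hgint₁ hgint₂, integral_indicator hAm, integral_indicator hBm,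
      setIntegral_const, setIntegral_const]
    exact hcenter
  have hg_mem_a : ∀ β ∈ A, g β = a - m := fun β h => by
    simp [hg, Set.indicator_of_mem h, Set.indicator_of_notMem (Set.disjoint_left.1 hAB h)]
  have hg_mem_b : ∀ β ∈ B, g β = b - m := fun β h => by
    simp [hg, Set.indicator_of_mem h, Set.indicator_of_notMem (Set.disjoint_right.1 hAB h)]
  have hg_notMem : ∀ β, β ∉ A ∪ B → g β = 0 := fun β h => by
    simp [hg, Set.indicator_of_notMem fun h' => h (Or.inl h'),
      Set.indicator_of_notMem fun h' => h (Or.inr h')]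
  have hg_le : ∀ β, |g β| ≤ 1 := by
    intro β
    by_cases h : β ∈ A ∪ B
    · rcases h with h | h
      · rw [hg_mem_a β h, abs_le]
        constructor <;> linarith
      · rw [hg_mem_b β h, abs_le]
        constructor <;> linarith
    · rw [hg_notMem β h]
      simp
  have hf_le : ∀ β, |S.indicator (fun β => x t β - m) β| ≤ 2 := by
    intro β
    by_cases h : β ∈ S
    · have h2 := abs_lt.1 (show |v - x t β| < 1 from h)
      rw [Set.indicator_of_mem h, abs_le]
      constructor <;> linarith [h2.1, h2.2]
    · rw [Set.indicator_of_notMem h]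
      simp
  have hfint : Integrable (S.indicator fun β => x t β - m) agentMeasure := hxint.indicator hSm
  have hbound : |∫ β in S, (x t β - m) ∂agentMeasure| ≤ 4 * η := by
    have h1 : ∫ β in S, (x t β - m) ∂agentMeasure =
        ∫ β, (S.indicator (fun β => x t β - m) β - g β) ∂agentMeasure := by
      rw [integral_sub hfint hgint, hg0, sub_zero, integral_indicator hSm]
    have h2 : ∫ β, (η + E.indicator (fun _ => 3) β) ∂agentMeasure ≤ 4 * η := by
      rw [integral_add (integrable_const _) ((integrable_const _).indicator hEm),
        integral_indicator hEm, integral_const, probReal_univ, setIntegral_const, smul_eq_mul,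
        smul_eq_mul]
      linarith
    rw [h1]
    refine (norm_integral_le_of_norm_le (μ := agentMeasure)
      (f := fun β => S.indicator (fun β => x t β - m) β - g β) ((integrable_const η).add
      ((integrable_const (3 : ℝ)).indicator hEm)) (ae_agentMeasure fun β hβ => ?_)).trans h2
    rw [Real.norm_eq_abs, Pi.add_apply]
    by_cases hβE : β ∈ E
    · rw [Set.indicator_of_mem hβE]
      linarith [abs_sub (S.indicator (fun β => x t β - m) β) (g β), hg_le β, hf_le β]
    · rw [Set.indicator_of_notMem hβE, add_zero]
      have h3 : |x t β - s β| < η := not_le.1 fun h => hβE h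
      by_cases h : β ∈ A ∪ B
      · rw [Set.indicator_of_mem (hS_of_mem β hβE h)]
        rcases h with h | h
        · rw [hg_mem_a β h, sub_sub_sub_cancel_right]
          have h' : s β = a := h
          rw [← h']
          exact h3.le
        · rw [hg_mem_b β h, sub_sub_sub_cancel_right]
          have h' : s β = b := h
          rw [← h']
          exact h3.le
      · rw [Set.indicator_of_notMem (hS_of_notMem β hβ hβE h), hg_notMem β h]
        simpa using hη.le
  rw [hupd, abs_div, abs_of_pos hdeg_pos, div_le_iff₀ hdeg_pos]
  nlinarith

lemma exists_agent_close {f s : ℝ → ℝ} {c η : ℝ} (hη : η < muPoint s c)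
    (hclose : agentMeasure {β | η ≤ |f β - s β|} < ENNReal.ofReal η) :
    ∃ β ∈ Set.Icc (0 : ℝ) 1, s β = c ∧ |f β - s β| < η := by
  by_contra! h
  have h1 : agentMeasure {β | s β = c} ≤ agentMeasure {β | η ≤ |f β - s β|} := by
    refine measure_mono_ae ?_
    filter_upwards [ae_restrict_mem measurableSet_Icc] with β hβ hβc using h β hβ hβc
  rw [muPoint_eq, measureReal_def] at hη
  exact absurd (h1.trans_lt hclose) (not_lt.2 (ENNReal.ofReal_le_of_le_toReal hη.le))

lemma exists_agent_eq {s : ℝ → ℝ} {c : ℝ} (h : 0 < muPoint s c) :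
    ∃ β ∈ Set.Icc (0 : ℝ) 1, s β = c := by
  by_contra! h'
  have : {α ∈ Set.Icc (0 : ℝ) 1 | s α = c} = ∅ :=
    Set.eq_empty_of_forall_notMem fun α hα => h' α hα.1 hα.2
  rw [muPoint, this, measure_empty, ENNReal.toReal_zero] at h
  exact h.false

/-- A limit in `Fset` cannot have two clusters whose centre of mass interacts with both. -/
lemma IsKrauseTraj.not_both_near_center {L : ℝ} {x : ℕ → ℝ → ℝ} (hx : IsKrauseTraj L x)
    (hdiff : ∀ t, DiffuseOpinion (x t)) {s : ℝ → ℝ} (hs : s ∈ Fset L) (hxs : TendstoMu x s)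
    {a b m : ℝ} (ha : 0 < muPoint s a) (hb : 0 < muPoint s b) (ham : a < m) (hmb : m < b)
    (hma : m - a < 1) (hbm : b - m < 1)
    (hcenter : muPoint s a * (a - m) + muPoint s b * (b - m) = 0) : False := by
  obtain ⟨δ, hδ, h1, h2, h3, h4⟩ : ∃ δ > 0, a + 2 * δ < m ∧ m + 2 * δ < b ∧
      m - a + 2 * δ < 1 ∧ b - m + 2 * δ < 1 := by
    set r := min (min (m - a) (b - m)) (min (1 - (m - a)) (1 - (b - m))) with hr
    have hr0 : 0 < r := by
      simp only [hr, lt_min_iff]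
      refine ⟨⟨?_, ?_⟩, ?_, ?_⟩ <;> linarith
    obtain ⟨⟨h1, h2⟩, h3, h4⟩ : (r ≤ m - a ∧ r ≤ b - m) ∧ r ≤ 1 - (m - a) ∧ r ≤ 1 - (b - m) := by
      simpa only [le_min_iff] using hr.le
    refine ⟨r / 3, by linarith, ?_, ?_, ?_, ?_⟩ <;> linarith
  set W := muPoint s a + muPoint s b
  obtain ⟨η, hη, hηδ, hηa, hηb, hηδW⟩ : ∃ η > 0, η ≤ δ ∧ 2 * η ≤ muPoint s a ∧
      2 * η ≤ muPoint s b ∧ 8 * η ≤ δ * W := by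
    have hW0 : 0 < δ * W := mul_pos hδ (add_pos ha hb)
    set r := min (min δ (muPoint s a)) (min (muPoint s b) (δ * W)) with hr
    have hr0 : 0 < r := by
      simp only [hr, lt_min_iff]
      exact ⟨⟨hδ, ha⟩, hb, hW0⟩
    obtain ⟨⟨h1, h2⟩, h3, h4⟩ : (r ≤ δ ∧ r ≤ muPoint s a) ∧ r ≤ muPoint s b ∧ r ≤ δ * W := by
      simpa only [le_min_iff] using hr.le
    refine ⟨r / 8, by linarith, ?_, ?_, ?_, ?_⟩ <;> linarith
  have hsa := exists_agent_eq ha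
  have hsb := exists_agent_eq hb
  obtain ⟨T, hT⟩ := hxs η hη
  simp only [volume_sep_Icc] at hT
  set Q := x T ⁻¹' Set.Ioo (m - δ) (m + δ) with hQ
  have hQ0 : 0 < agentMeasure Q := by
    obtain ⟨α, hα, hαa, hα'⟩ := exists_agent_close (c := a) (by linarith) (hT T le_rfl)
    obtain ⟨β, hβ, hβb, hβ'⟩ := exists_agent_close (c := b) (by linarith) (hT T le_rfl)
    rw [← Measure.map_apply (hx.1 T) measurableSet_Ioo]
    refine (hdiff T).2 _ _ ?_ (by linarith) ?_
    · linarith [sInf_image_le (hx.2.1 T) hα, (abs_lt.1 hα').2]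
    · linarith [le_sSup_image (hx.2.1 T) hβ, (abs_lt.1 hβ').1]
  have hstay : ∀ t ≥ T, ∀ α ∈ Set.Icc (0 : ℝ) 1, α ∈ Q → |x t α - m| ≤ δ := by
    intro t ht α hα hαQ
    induction t, ht using Nat.le_induction with
    | base => exact abs_le.2 ⟨by linarith [hαQ.1], by linarith [hαQ.2]⟩
    | succ t ht ih =>
      exact hx.abs_succ_sub_le hs hsa hsb hδ h1 h2 h3 h4 hcenter hηδ (by linarith) hηδW
        (hT t ht) hα ih
  have hfar : ∀ t ≥ T, ∀ α ∈ Set.Icc (0 : ℝ) 1, α ∈ Q → δ ≤ |x t α - s α| := by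
    intro t ht α hα hαQ
    obtain ⟨h5, h6⟩ := abs_le.1 (hstay t ht α hα hαQ)
    obtain ⟨αa, hαa, rfl⟩ := hsa
    obtain ⟨αb, hαb, rfl⟩ := hsb
    rw [le_abs]
    rcases hs.2.2 α hα αa hαa with h | h
    · left; linarith
    rcases hs.2.2 α hα αb hαb with h' | h'
    · right; linarith
    rcases le_abs.1 h with h | h <;> rcases le_abs.1 h' with h' | h'
    · right; linarith
    · right; linarith
    · left; linarith
    · left; linarith
  have hQ1 : 0 < (agentMeasure Q).toReal := ENNReal.toReal_pos hQ0.ne' (measure_ne_top _ _)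
  obtain ⟨T', hT'⟩ := hxs (min δ (agentMeasure Q).toReal) (lt_min hδ hQ1)
  have hlt := hT' (max T T') (le_max_right _ _)
  rw [volume_sep_Icc] at hlt
  have hle : agentMeasure Q ≤
      agentMeasure {α | min δ (agentMeasure Q).toReal ≤ |x (max T T') α - s α|} := by
    refine measure_mono_ae ?_
    filter_upwards [ae_restrict_mem measurableSet_Icc] with α hα hαQ
    exact (min_le_left _ _).trans (hfar _ (le_max_left _ _) α hα hαQ)
  refine absurd (hle.trans_lt hlt) (not_lt.2 ?_)
  exact ENNReal.ofReal_le_of_le_toReal (min_le_right _ _)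

lemma IsKrauseTraj.one_add_min_div_max_le {L : ℝ} {x : ℕ → ℝ → ℝ} (hx : IsKrauseTraj L x)
    (hdiff : ∀ t, DiffuseOpinion (x t)) {s : ℝ → ℝ} (hs : s ∈ Fset L) (hxs : TendstoMu x s)
    {a b : ℝ} (hab : a < b) (ha : 0 < muPoint s a) (hb : 0 < muPoint s b) :
    1 + min (muPoint s a) (muPoint s b) / max (muPoint s a) (muPoint s b) ≤ b - a := by
  by_contra! hlt
  have hmax : 0 < max (muPoint s a) (muPoint s b) := lt_max_of_lt_left ha
  have hmin : 0 < min (muPoint s a) (muPoint s b) := lt_min ha hb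
  set A := muPoint s a with hA
  set B := muPoint s b with hB
  have hW : 0 < A + B := add_pos ha hb
  have hratio : ∀ c, c ≤ max A B → c * (min A B / max A B) ≤ min A B := fun c hc => by
    rw [mul_div_left_comm]
    exact mul_le_of_le_one_right hmin.le ((div_le_one hmax).2 hc)
  have hBA := (hratio B (le_max_right _ _)).trans (min_le_left _ _)
  have hAB := (hratio A (le_max_left _ _)).trans (min_le_right _ _)
  have hma : (A * a + B * b) / (A + B) - a = B * (b - a) / (A + B) := by
    field_simp
    ring
  have hbm : b - (A * a + B * b) / (A + B) = A * (b - a) / (A + B) := by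
    field_simp
    ring
  refine hx.not_both_near_center hdiff hs hxs (m := (A * a + B * b) / (A + B)) ha hb ?_ ?_ ?_ ?_ ?_
  · rw [← sub_pos, hma]
    exact div_pos (mul_pos hb (sub_pos.2 hab)) hW
  · rw [← sub_pos, hbm]
    exact div_pos (mul_pos ha (sub_pos.2 hab)) hW
  · rw [hma, div_lt_one hW]
    nlinarith
  · rw [hbm, div_lt_one hW]
    nlinarith
  · rw [← neg_sub _ a, hma, hbm, ← hA, ← hB]
    ring

/-- If a trajectory of the continuous-agent Krause model starts
from a regular function, keeps `sup x_t − inf x_t > 2` at all times, and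
converges in the `μ`-sense, then it converges to some `s ∈ F` whose distinct
positive-measure values `a, b` satisfy
`|b − a| ≥ 1 + min(μ_s(a), μ_s(b)) / max(μ_s(a), μ_s(b))`; in particular
`|b − a| ≥ 2` whenever `μ_s(a) = μ_s(b)`. -/
theorem krause_continuum_no_unstable_limit (L : ℝ) (hL : 0 < L)
    (x : ℕ → ℝ → ℝ) (htraj : IsKrauseTraj L x) (hreg : RegularOpinion (x 0))
    (hspread : ∀ t : ℕ,
      2 < sSup (x t '' Set.Icc (0 : ℝ) 1) - sInf (x t '' Set.Icc (0 : ℝ) 1))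
    (hconv : ∃ y : ℝ → ℝ, Measurable y ∧
      (∀ α ∈ Set.Icc (0 : ℝ) 1, y α ∈ Set.Icc (0 : ℝ) L) ∧ TendstoMu x y) :
    ∃ s ∈ Fset L, TendstoMu x s ∧
      ∀ a b : ℝ, a ≠ b → 0 < muPoint s a → 0 < muPoint s b →
        (1 + min (muPoint s a) (muPoint s b) /
            max (muPoint s a) (muPoint s b) ≤ |b - a|) ∧
        (muPoint s a = muPoint s b → 2 ≤ |b - a|) := by
  obtain ⟨y, hy, hyb, hxy⟩ := hconv
  obtain ⟨s, hs, hys⟩ := exists_mem_Fset_ae_eq hy hyb (htraj.ae_separated hy hxy)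
  have hxs := hxy.congr_ae hys
  have hdiff := htraj.diffuseOpinion hreg hspread
  refine ⟨s, hs, hxs, fun a b hab ha hb => ?_⟩
  have hmain : 1 + min (muPoint s a) (muPoint s b) / max (muPoint s a) (muPoint s b) ≤
      |b - a| := by
    rcases lt_or_gt_of_ne hab with h | h
    · exact (htraj.one_add_min_div_max_le hdiff hs hxs h ha hb).trans (le_abs_self _)
    · rw [abs_sub_comm, min_comm, max_comm]
      exact (htraj.one_add_min_div_max_le hdiff hs hxs h hb ha).trans (le_abs_self _)
  refine ⟨hmain, fun heq => ?_⟩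
  rw [heq, min_self, max_self, div_self hb.ne'] at hmain
  linarith
end

section
/- Let L > 0, let x₀ ∈ X_L be regular, let (x_t) be its trajectory under the continuous-agent Krause model, and let t* be a time such that sup_α x_t(α) − inf_α x_t(α) > 2 for all t ≤ t*. Then for every ε > 0 there exist a positive integer n, a partition of [0,1] into pairwise disjoint measurable sets J_1, …, J_n, and a vector x̂₀ ∈ [0,L]ⁿ such that, letting (x̂_t) be the trajectory of the n-agent discrete Krause model started from x̂₀, one has sup_α |x_t(α) − (G(x̂_t))(α)| ≤ ε for every t = 1, …, t*, where G(x̂) denotes the step function on [0,1] equal to the i-th component of x̂ on J_i. -/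
open MeasureTheory

/-- One step of the `n`-agent discrete Krause model. -/
noncomputable def dKrauseUpdate {n : ℕ} (x : Fin n → ℝ) : Fin n → ℝ := fun i =>
  (∑ j ∈ Finset.univ.filter (fun j => |x i - x j| < 1), x j) /
  ((Finset.univ.filter (fun j => |x i - x j| < 1)).card : ℝ)

/-- The average of `u` over the points where `u` is at distance less than one from `p`. -/
noncomputable def localMean {Ω : Type*} [MeasurableSpace Ω] (μ : Measure Ω) (u : Ω → ℝ)
    (p : ℝ) : ℝ :=
  (∫ ω in {ω | |p - u ω| < 1}, u ω ∂μ) / μ.real {ω | |p - u ω| < 1}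

/-- The function `u` takes values in `[A, B]`, and its law has density between `m` and `M`
on that interval. -/
structure IsRegularOn {Ω : Type*} [MeasurableSpace Ω] (μ : Measure Ω) (u : Ω → ℝ)
    (A B m M : ℝ) : Prop where
  measurable : Measurable u
  pos : 0 < m
  nonneg : 0 ≤ M
  mem : ∀ ω, u ω ∈ Set.Icc A B
  lower : ∀ a b, A ≤ a → a ≤ b → b ≤ B → m * (b - a) ≤ μ.real (u ⁻¹' Set.Icc a b)
  upper : ∀ a b, A ≤ a → a ≤ b → b ≤ B → μ.real (u ⁻¹' Set.Icc a b) ≤ M * (b - a)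

section LocalMean

variable {Ω : Type*} [MeasurableSpace Ω] {μ : Measure Ω} [IsProbabilityMeasure μ]

theorem measurableSet_abs_sub_lt {u : Ω → ℝ} (hu : Measurable u) (p r : ℝ) :
    MeasurableSet {ω | |p - u ω| < r} :=
  measurableSet_lt (by fun_prop) measurable_const

/-- Averages over neighbourhoods depend Lipschitz-continuously on both the centre and the
function, provided the law of the function has bounded density. -/
theorem abs_localMean_sub_localMean_le {u v : Ω → ℝ} (hu : Measurable u) (hv : Measurable v)
    {L M c δ p q : ℝ} (hL : 0 ≤ L) (hc : 0 < c) (hδ : 0 ≤ δ)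
    (huL : ∀ ω, |u ω| ≤ L) (hvL : ∀ ω, |v ω| ≤ L) (huv : ∀ ω, |u ω - v ω| ≤ δ)
    (hpq : |p - q| ≤ δ)
    (hM : ∀ a b, a ≤ b → μ.real (u ⁻¹' Set.Icc a b) ≤ M * (b - a))
    (hcp : c ≤ μ.real {ω | |p - u ω| < 1}) :
    |localMean μ u p - localMean μ v q| ≤ (1 + 16 * L * M) / c * δ := by
  unfold localMean
  have hSm := measurableSet_abs_sub_lt hu p 1
  have hTm := measurableSet_abs_sub_lt hv q 1
  set S := {ω | |p - u ω| < 1} with hS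
  set T := {ω | |q - v ω| < 1} with hT
  set E := u ⁻¹' Set.Icc (p - 1 - 2 * δ) (p - 1 + 2 * δ) ∪
    u ⁻¹' Set.Icc (p + 1 - 2 * δ) (p + 1 + 2 * δ) with hE
  have hEm : MeasurableSet E := (hu measurableSet_Icc).union (hu measurableSet_Icc)
  have hμE : μ.real E ≤ 8 * M * δ := by
    have h1 := hM (p - 1 - 2 * δ) (p - 1 + 2 * δ) (by linarith)
    have h2 := hM (p + 1 - 2 * δ) (p + 1 + 2 * δ) (by linarith)
    have h3 := measureReal_union_le (μ := μ) (u ⁻¹' Set.Icc (p - 1 - 2 * δ) (p - 1 + 2 * δ))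
      (u ⁻¹' Set.Icc (p + 1 - 2 * δ) (p + 1 + 2 * δ))
    rw [← hE] at h3
    linarith
  have hST : ∀ ω, ω ∉ E → (ω ∈ S ↔ ω ∈ T) := by
    intro ω hω
    have h1 := abs_le.1 (huv ω)
    have h2 := abs_le.1 hpq
    simp only [hE, Set.mem_union, Set.mem_preimage, Set.mem_Icc, not_or, not_and, not_le] at hω
    simp only [hS, hT, Set.mem_ofPred_eq, abs_lt]
    constructor
    · rintro ⟨h3, h4⟩
      constructor
      · by_contra! h
        have := hω.2 (by linarith)
        linarith
      · by_contra! h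
        have := hω.1 (by linarith)
        linarith
    · rintro ⟨h3, h4⟩
      constructor
      · by_contra! h
        have := hω.2 (by linarith)
        linarith
      · by_contra! h
        have := hω.1 (by linarith)
        linarith
  have hui : Integrable u μ := .of_bound hu.aestronglyMeasurable L (.of_forall huL)
  have hvi : Integrable v μ := .of_bound hv.aestronglyMeasurable L (.of_forall hvL)
  have hEi : Integrable (E.indicator (fun _ => (1 : ℝ))) μ :=
    (integrable_const (1 : ℝ)).indicator hEm
  have hN : |∫ ω in S, u ω ∂μ - ∫ ω in T, v ω ∂μ| ≤ δ + L * μ.real E := by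
    rw [← integral_indicator hSm, ← integral_indicator hTm,
      ← integral_sub (hui.indicator hSm) (hvi.indicator hTm)]
    have hg : Integrable (fun ω => δ + L * E.indicator (fun _ => (1 : ℝ)) ω) μ :=
      (integrable_const δ).add (hEi.const_mul L)
    have hintegral : ∫ ω, (δ + L * E.indicator (fun _ => (1 : ℝ)) ω) ∂μ = δ + L * μ.real E := by
      rw [integral_add (integrable_const δ) (hEi.const_mul L), integral_const_mul,
        integral_indicator_const _ hEm]
      simp
    rw [← hintegral]
    refine norm_integral_le_of_norm_le (μ := μ) (G := ℝ) hg (.of_forall fun ω => ?_)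
    rw [Real.norm_eq_abs]
    by_cases h1 : ω ∈ E
    · by_cases h2 : ω ∈ S <;> by_cases h3 : ω ∈ T <;>
        simp only [h1, h2, h3, Set.indicator_of_mem, Set.indicator_of_notMem,
          not_false_eq_true, sub_zero, zero_sub, abs_neg, abs_zero]
      · linarith [huv ω]
      · linarith [huL ω]
      · linarith [hvL ω]
      · linarith
    · by_cases h2 : ω ∈ S
      · have h3 := (hST ω h1).1 h2
        simp [h1, h2, h3, huv ω]
      · have h3 := mt (hST ω h1).2 h2
        simp [h1, h2, h3, hδ]
  have hD : |μ.real S - μ.real T| ≤ μ.real E := by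
    have hs : μ.real S ≤ μ.real T + μ.real E :=
      (measureReal_mono (fun ω hω => by
        by_cases h : ω ∈ E
        · exact .inr h
        · exact .inl ((hST ω h).1 hω))).trans (measureReal_union_le T E)
    have ht : μ.real T ≤ μ.real S + μ.real E :=
      (measureReal_mono (fun ω hω => by
        by_cases h : ω ∈ E
        · exact .inr h
        · exact .inl ((hST ω h).2 hω))).trans (measureReal_union_le S E)
    rw [abs_le]
    constructor <;> linarith
  have hN' : |∫ ω in T, v ω ∂μ| ≤ L * μ.real T :=
    norm_setIntegral_le_of_norm_le_const (f := v) (measure_lt_top μ T) (fun ω _ => hvL ω)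
  have hS0 : 0 < μ.real S := hc.trans_le hcp
  have hT0 : 0 ≤ μ.real T := measureReal_nonneg
  set N := ∫ ω in S, u ω ∂μ
  set N' := ∫ ω in T, v ω ∂μ
  set R := N' / μ.real T with hR
  have hRT : N' = R * μ.real T := by
    rcases hT0.eq_or_lt with h | h
    · rw [← h, mul_zero] at hN' ⊢
      exact abs_nonpos_iff.1 hN'
    · rw [hR, div_mul_cancel₀ _ h.ne']
  have hRL : |R| ≤ L := by
    rw [hR, abs_div, abs_of_nonneg hT0]
    exact div_le_of_le_mul₀ hT0 hL hN'
  clear_value R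
  have key : N / μ.real S - R = ((N - N') + R * (μ.real T - μ.real S)) / μ.real S := by
    rw [hRT]
    field_simp
    ring
  have h0E : 0 ≤ μ.real E := measureReal_nonneg
  rw [key, abs_div, abs_of_pos hS0, div_mul_eq_mul_div]
  have h1 : |R * (μ.real T - μ.real S)| ≤ L * μ.real E := by
    rw [abs_mul, abs_sub_comm]
    exact mul_le_mul hRL hD (abs_nonneg _) hL
  have h2 : L * μ.real E ≤ L * (8 * M * δ) := mul_le_mul_of_nonneg_left hμE hL
  have h3 : |N - N' + R * (μ.real T - μ.real S)| ≤ (1 + 16 * L * M) * δ := by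
    linarith [abs_add_le (N - N') (R * (μ.real T - μ.real S))]
  exact div_le_div₀ ((abs_nonneg _).trans h3) h3 hc hcp

end LocalMean

namespace IsRegularOn

variable {Ω : Type*} [MeasurableSpace Ω] {μ : Measure Ω} {u : Ω → ℝ} {A B m M : ℝ}

theorem measureReal_Icc_le (h : IsRegularOn μ u A B m M) (a b : ℝ) (hab : a ≤ b) :
    μ.real (u ⁻¹' Set.Icc a b) ≤ M * (b - a) := by
  have hclip : u ⁻¹' Set.Icc a b = u ⁻¹' Set.Icc (max a A) (min b B) := by
    ext ω
    have := h.mem ω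
    simp only [Set.mem_preimage, Set.mem_Icc, max_le_iff, le_min_iff] at this ⊢
    tauto
  rw [hclip]
  by_cases hle : max a A ≤ min b B
  · refine (h.upper _ _ (le_max_right _ _) hle (min_le_right _ _)).trans ?_
    exact mul_le_mul_of_nonneg_left
      (by linarith [le_max_left a A, min_le_left b B]) h.nonneg
  · rw [Set.Icc_eq_empty hle]
    simpa using mul_nonneg h.nonneg (sub_nonneg.2 hab)

theorem abs_apply_le (h : IsRegularOn μ u A B m M) (ω : Ω) : |u ω| ≤ max |A| |B| :=
  abs_le_max_abs_abs (h.mem ω).1 (h.mem ω).2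

/-- Half of the unit neighbourhood of a point of `[A, B]` has a half-unit interval in `[A, B]`. -/
theorem exists_half_neighborhood (h : IsRegularOn μ u A B m M) (hAB : 2 < B - A) {y : ℝ}
    (hy : y ∈ Set.Icc A B) :
    ∃ E : Set Ω, MeasurableSet E ∧ m / 2 ≤ μ.real E ∧ ∀ ω ∈ E, |y - u ω| ≤ 1 / 2 := by
  rcases le_total y (A + 1) with hy1 | hy1
  · refine ⟨u ⁻¹' Set.Icc y (y + 1 / 2), h.measurable measurableSet_Icc, ?_, ?_⟩
    · linarith [h.lower y (y + 1 / 2) hy.1 (by linarith) (by linarith)]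
    · rintro ω ⟨h1, h2⟩
      rw [abs_le]
      constructor <;> linarith
  · refine ⟨u ⁻¹' Set.Icc (y - 1 / 2) y, h.measurable measurableSet_Icc, ?_, ?_⟩
    · linarith [h.lower (y - 1 / 2) y (by linarith) (by linarith) hy.2]
    · rintro ω ⟨h1, h2⟩
      rw [abs_le]
      constructor <;> linarith

variable [IsProbabilityMeasure μ]

theorem integrable (h : IsRegularOn μ u A B m M) : Integrable u μ :=
  .of_bound h.measurable.aestronglyMeasurable _ (.of_forall h.abs_apply_le)

theorem le_measureReal_neighborhood (h : IsRegularOn μ u A B m M) (hAB : 2 < B - A) {y : ℝ}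
    (hy : y ∈ Set.Icc A B) : m / 2 ≤ μ.real {ω | |y - u ω| < 1} := by
  obtain ⟨E, -, hmE, hE⟩ := h.exists_half_neighborhood hAB hy
  refine hmE.trans (measureReal_mono fun ω hω => ?_)
  have := hE ω hω
  simp only [Set.mem_ofPred_eq]
  linarith

/-- `localMean μ u y` stays away from the end points of the neighbourhood of `y`. -/
theorem localMean_mem (h : IsRegularOn μ u A B m M) (hAB : 2 < B - A) {y : ℝ}
    (hy : y ∈ Set.Icc A B) :
    localMean μ u y ∈ Set.Icc (y - 1 + m / 4) (y + 1 - m / 4) := by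
  obtain ⟨E, hEm, hmE, hE⟩ := h.exists_half_neighborhood hAB hy
  have hD0 := h.le_measureReal_neighborhood hAB hy
  have hSm := measurableSet_abs_sub_lt h.measurable y 1
  have hm := h.pos
  unfold localMean
  set S := {ω | |y - u ω| < 1}
  have hES : E ⊆ S := fun ω hω => (hE ω hω).trans_lt (by norm_num)
  have hD1 : μ.real S ≤ 1 := measureReal_le_one
  have hDp : 0 < μ.real S := by linarith
  have bound : ∀ g : Ω → ℝ, Integrable g μ → (∀ ω ∈ S, 0 ≤ g ω) → (∀ ω ∈ E, 1 / 2 ≤ g ω) →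
      m / 4 ≤ ∫ ω in S, g ω ∂μ := by
    intro g hg hgS hgE
    calc m / 4 ≤ 1 / 2 * μ.real E := by linarith
      _ ≤ ∫ ω in E, g ω ∂μ := by
          have := setIntegral_mono_on (integrable_const (1 / 2 : ℝ)).integrableOn hg.integrableOn
            hEm hgE
          simpa [mul_comm] using this
      _ ≤ ∫ ω in S, g ω ∂μ :=
          setIntegral_mono_set hg.integrableOn ((ae_restrict_iff' hSm).2 (.of_forall hgS))
            (.of_forall hES)
  have h1 := bound (fun ω => (y + 1) - u ω) ((integrable_const _).sub h.integrable)
    (fun ω hω => by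
      have h3 : |y - u ω| < 1 := hω
      linarith [(abs_lt.1 h3).1, (abs_lt.1 h3).2])
    (fun ω hω => by have := abs_le.1 (hE ω hω); linarith)
  have h2 := bound (fun ω => u ω - (y - 1)) (h.integrable.sub (integrable_const _))
    (fun ω hω => by
      have h3 : |y - u ω| < 1 := hω
      linarith [(abs_lt.1 h3).1, (abs_lt.1 h3).2])
    (fun ω hω => by have := abs_le.1 (hE ω hω); linarith)
  rw [integral_sub (integrable_const _) h.integrable.integrableOn, setIntegral_const,
    smul_eq_mul] at h1
  rw [integral_sub h.integrable.integrableOn (integrable_const _), setIntegral_const,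
    smul_eq_mul] at h2
  constructor
  · rw [le_div_iff₀ hDp]
    nlinarith
  · rw [div_le_iff₀ hDp]
    nlinarith

theorem lipschitz_localMean (h : IsRegularOn μ u A B m M) (hAB : 2 < B - A) {y z : ℝ}
    (hy : y ∈ Set.Icc A B) :
    |localMean μ u y - localMean μ u z| ≤
      (1 + 16 * max |A| |B| * M) / (m / 2) * |y - z| :=
  abs_localMean_sub_localMean_le h.measurable h.measurable (by positivity)
    (by linarith [h.pos]) (abs_nonneg _) h.abs_apply_le h.abs_apply_le (fun ω => by simp) le_rfl
    h.measureReal_Icc_le (h.le_measureReal_neighborhood hAB hy)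

/-- Over short distances, `localMean μ u` grows at least linearly. -/
theorem le_localMean_sub_of_le (h : IsRegularOn μ u A B m M) (hAB : 2 < B - A) {y z : ℝ}
    (hy : y ∈ Set.Icc A B) (hz : z ∈ Set.Icc A B) (hyz : y ≤ z)
    (hm8 : z - y ≤ m / 8) (h1 : z - y ≤ 1) (hgap : z - y ≤ B - A - 2) :
    m ^ 2 / 16 * (z - y) ≤ localMean μ u z - localMean μ u y := by
  have hm := h.pos
  obtain ⟨hp1, hp2⟩ := h.localMean_mem hAB hy
  have hSm := measurableSet_abs_sub_lt h.measurable y 1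
  have hTm := measurableSet_abs_sub_lt h.measurable z 1
  have hSp : 0 < μ.real {ω | |y - u ω| < 1} :=
    (half_pos hm).trans_le (h.le_measureReal_neighborhood hAB hy)
  have hTp : 0 < μ.real {ω | |z - u ω| < 1} :=
    (half_pos hm).trans_le (h.le_measureReal_neighborhood hAB hz)
  set p := localMean μ u y with hp
  set q := localMean μ u z with hq
  unfold localMean at hp hq
  set S := {ω | |y - u ω| < 1} with hS
  set T := {ω | |z - u ω| < 1} with hT
  have hg : Integrable (fun ω => u ω - p) μ := h.integrable.sub (integrable_const p)
  have hIS : ∫ ω in S, (u ω - p) ∂μ = 0 := by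
    rw [integral_sub h.integrable.integrableOn (integrable_const _), setIntegral_const,
      smul_eq_mul, hp]
    field_simp
    ring
  have hIT : ∫ ω in T, (u ω - p) ∂μ = (q - p) * μ.real T := by
    rw [integral_sub h.integrable.integrableOn (integrable_const _), setIntegral_const,
      smul_eq_mul, hq]
    field_simp
  have e1 := integral_inter_add_sdiff hSm (s := T) hg.integrableOn
  have e2 := integral_inter_add_sdiff hTm (s := S) hg.integrableOn
  rw [Set.inter_comm] at e2
  have hR : m / 8 * μ.real (T \ S) ≤ ∫ ω in T \ S, (u ω - p) ∂μ := by
    have := setIntegral_mono_on (integrable_const (m / 8 : ℝ)).integrableOn hg.integrableOn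
      (hTm.diff hSm) (fun ω hω => by
        have h3 : |z - u ω| < 1 := hω.1
        rw [abs_lt] at h3
        have h4 : ¬ |y - u ω| < 1 := hω.2
        rw [abs_lt, not_and_or, not_lt, not_lt] at h4
        rcases h4 with h4 | h4 <;> linarith)
    simpa [mul_comm] using this
  have hLf : m / 8 * μ.real (S \ T) ≤ -∫ ω in S \ T, (u ω - p) ∂μ := by
    rw [← integral_neg]
    have := setIntegral_mono_on (integrable_const (m / 8 : ℝ)).integrableOn hg.neg.integrableOn
      (hSm.diff hTm) (fun ω hω => by
        have h3 : |y - u ω| < 1 := hω.1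
        rw [abs_lt] at h3
        have h4 : ¬ |z - u ω| < 1 := hω.2
        rw [abs_lt, not_and_or, not_lt, not_lt] at h4
        simp only [Pi.neg_apply]
        rcases h4 with h4 | h4 <;> linarith)
    simpa [mul_comm] using this
  have hmass : m * ((z - y) / 2) ≤ μ.real (T \ S) + μ.real (S \ T) := by
    rcases hyz.eq_or_lt with rfl | hlt
    · simp only [sub_self, zero_div, mul_zero]
      positivity
    rcases le_total (z + 1) B with hB | hB
    · have h3 := h.lower (y + 1) (y + 1 + (z - y) / 2) (by linarith [hy.1]) (by linarith)
        (by linarith)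
      have h4 : μ.real (u ⁻¹' Set.Icc (y + 1) (y + 1 + (z - y) / 2)) ≤ μ.real (T \ S) := by
        refine measureReal_mono ?_
        rintro ω ⟨h5, h6⟩
        simp only [hS, hT, Set.mem_sdiff, Set.mem_ofPred_eq, abs_lt]
        refine ⟨⟨by linarith, by linarith⟩, fun h7 => by linarith⟩
      have h5 : 0 ≤ μ.real (S \ T) := measureReal_nonneg
      linarith
    · have h3 := h.lower (z - 1 - (z - y) / 2) (z - 1) (by linarith) (by linarith)
        (by linarith [hz.2])
      have h4 : μ.real (u ⁻¹' Set.Icc (z - 1 - (z - y) / 2) (z - 1)) ≤ μ.real (S \ T) := by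
        refine measureReal_mono ?_
        rintro ω ⟨h5, h6⟩
        simp only [hS, hT, Set.mem_sdiff, Set.mem_ofPred_eq, abs_lt]
        refine ⟨⟨by linarith, by linarith⟩, fun h7 => by linarith⟩
      have h5 : 0 ≤ μ.real (T \ S) := measureReal_nonneg
      linarith
  have hT1 : μ.real T ≤ 1 := measureReal_le_one
  have hfin : m ^ 2 / 16 * (z - y) ≤ (q - p) * μ.real T := by
    have : m / 8 * (m * ((z - y) / 2)) ≤ m / 8 * (μ.real (T \ S) + μ.real (S \ T)) :=
      mul_le_mul_of_nonneg_left hmass (by positivity)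
    linarith
  have hnn : 0 ≤ m ^ 2 / 16 * (z - y) := mul_nonneg (by positivity) (sub_nonneg.2 hyz)
  have hqp : 0 ≤ q - p := by
    by_contra! hlt
    nlinarith
  nlinarith

/-- On an interval, a lower bound on slopes over short distances is a lower bound on all slopes. -/
theorem mul_sub_le_sub_of_forall_short {f : ℝ → ℝ} {A B k d : ℝ} (hd : 0 < d)
    (h : ∀ y ∈ Set.Icc A B, ∀ z ∈ Set.Icc A B, y ≤ z → z - y ≤ d → k * (z - y) ≤ f z - f y)
    {y z : ℝ} (hy : y ∈ Set.Icc A B) (hz : z ∈ Set.Icc A B) (hyz : y ≤ z) :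
    k * (z - y) ≤ f z - f y := by
  have step : ∀ N : ℕ, ∀ y ∈ Set.Icc A B, ∀ z ∈ Set.Icc A B, y ≤ z → z - y ≤ N * d →
      k * (z - y) ≤ f z - f y := by
    intro N
    induction N with
    | zero =>
      intro y hy z hz hyz hle
      exact h y hy z hz hyz (hle.trans (by simpa using hd.le))
    | succ N ih =>
      intro y hy z hz hyz hle
      push_cast at hle
      rcases le_total (z - y) d with hs | hs
      · exact h y hy z hz hyz hs
      · have hw : y + d ∈ Set.Icc A B := ⟨by linarith [hy.1], by linarith [hz.2]⟩
        have h1 := h y hy (y + d) hw (by linarith) (by linarith)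
        have h2 := ih (y + d) hw z hz (by linarith) (by linarith)
        linarith
  obtain ⟨N, hN⟩ := exists_nat_ge ((z - y) / d)
  exact step N y hy z hz hyz ((div_le_iff₀ hd).1 hN)

theorem exists_le_localMean_sub (h : IsRegularOn μ u A B m M) (hAB : 2 < B - A) :
    ∃ k > 0, ∀ y ∈ Set.Icc A B, ∀ z ∈ Set.Icc A B, y ≤ z →
      k * (z - y) ≤ localMean μ u z - localMean μ u y := by
  have hm := h.pos
  refine ⟨m ^ 2 / 16, by positivity, fun y hy z hz hyz =>
    mul_sub_le_sub_of_forall_short (d := min (min (m / 8) 1) (B - A - 2)) ?_ ?_ hy hz hyz⟩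
  · exact lt_min (lt_min (by positivity) one_pos) (by linarith)
  · intro y hy z hz hyz hle
    rw [le_min_iff, le_min_iff] at hle
    exact h.le_localMean_sub_of_le hAB hy hz hyz hle.1.1 hle.1.2 hle.2

/-- Regularity is preserved by one step of the Krause dynamics as long as the spread of
opinions exceeds two. -/
theorem exists_isRegularOn_of_eq_localMean (h : IsRegularOn μ u A B m M) (hAB : 2 < B - A)
    {v : Ω → ℝ} (hv : Measurable v) (huv : ∀ ω, v ω = localMean μ u (u ω)) :
    ∃ A' B' m' M', IsRegularOn μ v A' B' m' M' := by
  obtain ⟨k, hk, hlow⟩ := h.exists_le_localMean_sub hAB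
  obtain ⟨K, hK, hup⟩ : ∃ K > 0, ∀ y ∈ Set.Icc A B, ∀ z,
      |localMean μ u y - localMean μ u z| ≤ K * |y - z| := by
    have hm := h.pos
    have hM := h.nonneg
    exact ⟨(1 + 16 * max |A| |B| * M) / (m / 2), by positivity,
      fun y hy z => h.lipschitz_localMean hAB hy⟩
  set f := localMean μ u
  have hm := h.pos
  have hM := h.nonneg
  have hAB' : A ≤ B := by linarith
  have hA : A ∈ Set.Icc A B := Set.left_mem_Icc.2 hAB'
  have hB : B ∈ Set.Icc A B := Set.right_mem_Icc.2 hAB'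
  have hmono : StrictMonoOn f (Set.Icc A B) := by
    intro y hy z hz hyz
    have h1 := hlow y hy z hz hyz.le
    have h2 : 0 < k * (z - y) := mul_pos hk (sub_pos.2 hyz)
    linarith
  have hcont : ContinuousOn f (Set.Icc A B) :=
    (LipschitzOnWith.of_dist_le_mul (K := ⟨K, hK.le⟩)
      fun y hy z _ => hup y hy z).continuousOn
  have hpre : ∀ c d, f A ≤ c → c ≤ d → d ≤ f B → ∃ a b, A ≤ a ∧ a ≤ b ∧ b ≤ B ∧
      f a = c ∧ f b = d ∧ v ⁻¹' Set.Icc c d = u ⁻¹' Set.Icc a b := by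
    intro c d hc hcd hd
    obtain ⟨a, ha, rfl⟩ := intermediate_value_Icc hAB' hcont ⟨hc, hcd.trans hd⟩
    obtain ⟨b, hb, rfl⟩ := intermediate_value_Icc hAB' hcont ⟨hc.trans hcd, hd⟩
    refine ⟨a, b, ha.1, (hmono.le_iff_le ha hb).1 hcd, hb.2, rfl, rfl, ?_⟩
    ext ω
    simp only [Set.mem_preimage, Set.mem_Icc, huv]
    rw [hmono.le_iff_le ha (h.mem ω), hmono.le_iff_le (h.mem ω) hb]
  refine ⟨f A, f B, m / K, M / k, hv, by positivity, by positivity, fun ω => ?_, ?_, ?_⟩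
  · rw [huv]
    exact ⟨(hmono.le_iff_le hA (h.mem ω)).2 (h.mem ω).1,
      (hmono.le_iff_le (h.mem ω) hB).2 (h.mem ω).2⟩
  · intro c d hc hcd hd
    obtain ⟨a, b, ha, hab, hb, rfl, rfl, he⟩ := hpre c d hc hcd hd
    rw [he, div_mul_eq_mul_div, div_le_iff₀ hK]
    have h1 := h.lower a b ha hab hb
    have h2 := (le_abs_self _).trans (hup b ⟨ha.trans hab, hb⟩ a)
    rw [abs_of_nonneg (sub_nonneg.2 hab)] at h2
    nlinarith
  · intro c d hc hcd hd
    obtain ⟨a, b, ha, hab, hb, rfl, rfl, he⟩ := hpre c d hc hcd hd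
    rw [he, div_mul_eq_mul_div, le_div_iff₀ hk]
    have h1 := h.upper a b ha hab hb
    have h2 := hlow a ⟨ha, hab.trans hb⟩ b ⟨ha.trans hab, hb⟩ hab
    nlinarith

/-- A regular function splits the space into `n` pieces of equal measure on each of which it
varies by at most `1 / (n * m)`. -/
theorem exists_equipartition (h : IsRegularOn μ u A B m M) (hAB : A ≤ B) {n : ℕ} (hn : 0 < n) :
    ∃ g : Ω → Fin n, Measurable g ∧ (∀ i, μ.real (g ⁻¹' {i}) = 1 / n) ∧
      ∀ ω ω', g ω = g ω' → |u ω - u ω'| ≤ 1 / (n * m) := by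
  have hm := h.pos
  have hn' : (0 : ℝ) < n := by exact_mod_cast hn
  set F : ℝ → ℝ := fun y => μ.real (u ⁻¹' Set.Icc A y) with hF
  have hpt : ∀ y, μ.real (u ⁻¹' Set.Icc y y) = 0 := fun y =>
    le_antisymm (by simpa using h.measureReal_Icc_le y y le_rfl) measureReal_nonneg
  have hFsub : ∀ a b, A ≤ a → a ≤ b → F b - F a = μ.real (u ⁻¹' Set.Icc a b) := by
    intro a b ha hab
    have h1 : u ⁻¹' Set.Icc A b = u ⁻¹' Set.Icc A a ∪ u ⁻¹' Set.Ioc a b := by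
      rw [← Set.preimage_union, Set.Icc_union_Ioc_eq_Icc ha hab]
    have h2 : μ.real (u ⁻¹' Set.Icc A b) =
        μ.real (u ⁻¹' Set.Icc A a) + μ.real (u ⁻¹' Set.Ioc a b) := by
      rw [h1]
      refine measureReal_union ?_ (h.measurable measurableSet_Ioc)
      exact Set.disjoint_left.2 fun ω h3 h4 => not_lt.2 h3.2 h4.1
    have h3 : μ.real (u ⁻¹' Set.Icc a b) ≤ μ.real (u ⁻¹' Set.Ioc a b) +
        μ.real (u ⁻¹' Set.Icc a a) := by
      refine (measureReal_mono fun ω hω => ?_).trans (measureReal_union_le _ _)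
      rcases hω.1.eq_or_lt with h4 | h4
      · exact .inr ⟨h4.le, h4.ge⟩
      · exact .inl ⟨h4, hω.2⟩
    have h4 : μ.real (u ⁻¹' Set.Ioc a b) ≤ μ.real (u ⁻¹' Set.Icc a b) :=
      measureReal_mono (Set.preimage_mono Set.Ioc_subset_Icc_self)
    simp only [hF]
    linarith [hpt a]
  have hF01 : ∀ y, F y ∈ Set.Icc (0 : ℝ) 1 := fun y => ⟨measureReal_nonneg, measureReal_le_one⟩
  have hFmono : Monotone F := fun a b hab =>
    measureReal_mono (Set.preimage_mono (Set.Icc_subset_Icc_right hab))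
  have hFA : F A = 0 := hpt A
  have hFB : F B = 1 := by
    have : u ⁻¹' Set.Icc A B = Set.univ := Set.eq_univ_of_forall h.mem
    simp [hF, this]
  have hlow : ∀ y ∈ Set.Icc A B, ∀ z ∈ Set.Icc A B, m * |y - z| ≤ |F y - F z| := by
    intro y hy z hz
    wlog hyz : y ≤ z generalizing y z
    · rw [abs_sub_comm y, abs_sub_comm (F y)]
      exact this z hz y hy (le_of_not_ge hyz)
    rw [abs_sub_comm y, abs_sub_comm (F y), abs_of_nonneg (sub_nonneg.2 hyz),
      abs_of_nonneg (sub_nonneg.2 (hFmono hyz)), hFsub y z hy.1 hyz]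
    exact h.lower y z hy.1 hyz hz.2
  have hcont : ContinuousOn F (Set.Icc A B) := by
    refine (LipschitzOnWith.of_dist_le_mul (K := ⟨M, h.nonneg⟩)
      fun y hy z hz => ?_).continuousOn
    rw [Real.dist_eq, Real.dist_eq]
    change _ ≤ M * |y - z|
    wlog hyz : y ≤ z generalizing y z
    · rw [abs_sub_comm y, abs_sub_comm (F y)]
      exact this z hz y hy (le_of_not_ge hyz)
    rw [abs_sub_comm y, abs_sub_comm (F y), abs_of_nonneg (sub_nonneg.2 hyz),
      abs_of_nonneg (sub_nonneg.2 (hFmono hyz)), hFsub y z hy.1 hyz]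
    exact h.measureReal_Icc_le y z hyz
  set U : Ω → ℝ := fun ω => F (u ω)
  have hUm : Measurable U := hFmono.measurable.comp h.measurable
  have hunif : ∀ s ∈ Set.Icc (0 : ℝ) 1, μ.real {ω | U ω < s} = s := by
    intro s hs
    rw [← hFA, ← hFB] at hs
    obtain ⟨q, hq, rfl⟩ := intermediate_value_Icc hAB hcont hs
    have h1 : {ω | U ω < F q} ⊆ u ⁻¹' Set.Icc A q := fun ω hω =>
      ⟨(h.mem ω).1, le_of_not_gt fun hlt => not_lt.2 (hFmono hlt.le) hω⟩
    have h2 : u ⁻¹' Set.Icc A q ⊆ {ω | U ω < F q} ∪ u ⁻¹' Set.Icc q q := by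
      intro ω hω
      rcases hω.2.eq_or_lt with h3 | h3
      · exact .inr ⟨h3.ge, h3.le⟩
      · refine .inl ((hFmono h3.le).lt_of_ne fun h4 => ?_)
        have h5 := hlow (u ω) (h.mem ω) q hq
        rw [h4, sub_self, abs_zero] at h5
        have h6 : 0 < m * |u ω - q| := mul_pos hm (abs_pos.2 (sub_ne_zero.2 h3.ne))
        linarith
    have h3 : μ.real {ω | U ω < F q} ≤ F q := measureReal_mono h1
    have h4 := (measureReal_mono (μ := μ) h2).trans (measureReal_union_le _ _)
    rw [hpt q, add_zero] at h4
    exact le_antisymm h3 h4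
  refine ⟨fun ω => ⟨min ⌊n * U ω⌋₊ (n - 1), by omega⟩, ?_, ?_, ?_⟩
  · have h1 : Measurable fun ω => ⌊(n : ℝ) * U ω⌋₊ := Nat.measurable_floor.comp (hUm.const_mul _)
    refine measurable_to_countable' fun i => ?_
    have h2 : Measurable fun ω => min ⌊(n : ℝ) * U ω⌋₊ (n - 1) := h1.min measurable_const
    convert h2 (measurableSet_singleton (i : ℕ)) using 1
    ext ω
    simp [Fin.ext_iff]
  · rintro ⟨i, hi⟩
    have hi' : (i : ℝ) + 1 ≤ n := by exact_mod_cast hi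
    have hU0 : ∀ ω, 0 ≤ n * U ω := fun ω => mul_nonneg hn'.le (hF01 _).1
    have hs1 : (i : ℝ) / n ∈ Set.Icc (0 : ℝ) 1 :=
      ⟨by positivity, (div_le_one hn').2 (by linarith)⟩
    have hs2 : ((i : ℝ) + 1) / n ∈ Set.Icc (0 : ℝ) 1 :=
      ⟨by positivity, (div_le_one hn').2 hi'⟩
    have hmeas : ∀ s, MeasurableSet {ω | U ω < s} := fun s => measurableSet_lt hUm measurable_const
    have hdiff : μ.real ({ω | U ω < (i + 1) / n} \ {ω | U ω < i / n}) = 1 / n := by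
      have hsub : {ω | U ω < i / n} ⊆ {ω | U ω < (i + 1) / n} := fun ω hω =>
        lt_of_lt_of_le (show U ω < i / n from hω) (by gcongr; linarith)
      rw [measureReal_sdiff hsub (hmeas _), hunif _ hs1, hunif _ hs2]
      ring
    have hone : ∀ᵐ ω ∂μ, U ω < 1 := by
      have h1 : μ.real {ω | U ω < 1} = 1 := hunif 1 ⟨zero_le_one, le_rfl⟩
      have h2 := probReal_compl_eq_one_sub (μ := μ) (hmeas 1)
      rw [h1, sub_self, measureReal_eq_zero_iff] at h2
      exact h2
    rw [← hdiff]
    refine measureReal_congr ?_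
    filter_upwards [hone] with ω hω
    refine propext ?_
    change (⟨min ⌊n * U ω⌋₊ (n - 1), _⟩ : Fin n) = ⟨i, hi⟩ ↔
      U ω < (i + 1) / n ∧ ¬ U ω < i / n
    have hfl : ⌊n * U ω⌋₊ < n := by
      rw [Nat.floor_lt (hU0 ω)]
      nlinarith
    rw [Fin.mk.injEq, min_eq_left (by omega), Nat.floor_eq_iff (hU0 ω), not_lt,
      lt_div_iff₀ hn', div_le_iff₀ hn', mul_comm, and_comm]
  · intro ω ω' heq
    rw [Fin.mk.injEq] at heq
    have hcell : ∀ ω, ((min ⌊n * U ω⌋₊ (n - 1) : ℕ) : ℝ) ≤ n * U ω ∧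
        n * U ω ≤ ((min ⌊n * U ω⌋₊ (n - 1) : ℕ) : ℝ) + 1 := by
      intro ω
      have hU0 : 0 ≤ n * U ω := mul_nonneg hn'.le (hF01 _).1
      refine ⟨le_trans (by exact_mod_cast min_le_left _ _) (Nat.floor_le hU0), ?_⟩
      rcases min_choice ⌊n * U ω⌋₊ (n - 1) with h1 | h1
      · rw [h1]
        exact (Nat.lt_floor_add_one _).le
      · rw [h1, Nat.cast_pred hn, sub_add_cancel]
        exact mul_le_of_le_one_right hn'.le (hF01 _).2
    have h1 := hcell ω
    have h2 := hcell ω'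
    rw [← heq] at h2
    have h3 : (n : ℝ) * |U ω - U ω'| ≤ 1 := by
      rw [← Nat.abs_cast n, ← abs_mul, abs_le]
      constructor <;> linarith
    have h4 := hlow (u ω) (h.mem ω) (u ω') (h.mem ω')
    rw [le_div_iff₀ (by positivity)]
    nlinarith

end IsRegularOn

section Discretization

variable {Ω : Type*} [MeasurableSpace Ω] {μ : Measure Ω} [IsProbabilityMeasure μ]

theorem integral_comp_of_equipartition {n : ℕ} {g : Ω → Fin n} (hg : Measurable g)
    (hgn : ∀ i, μ.real (g ⁻¹' {i}) = 1 / n) (φ : Fin n → ℝ) :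
    ∫ ω, φ (g ω) ∂μ = (∑ i, φ i) / n := by
  rw [← integral_map hg.aemeasurable (measurable_of_finite φ).aestronglyMeasurable,
    integral_fintype .of_finite, Finset.sum_div]
  refine Finset.sum_congr rfl fun i _ => ?_
  rw [map_measureReal_apply hg (measurableSet_singleton i), hgn, smul_eq_mul]
  ring

/-- The discrete Krause update is the continuous one applied to the associated step function. -/
theorem dKrauseUpdate_eq_localMean {n : ℕ} {g : Ω → Fin n} (hg : Measurable g)
    (hgn : ∀ i, μ.real (g ⁻¹' {i}) = 1 / n) (y : Fin n → ℝ) (i : Fin n) :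
    dKrauseUpdate y i = localMean μ (fun ω => y (g ω)) (y i) := by
  have hn : (n : ℝ) ≠ 0 := by exact_mod_cast i.pos.ne'
  have hm : MeasurableSet {ω | |y i - y (g ω)| < 1} :=
    measurableSet_abs_sub_lt ((measurable_of_finite y).comp hg) _ _
  have key : ∀ φ : Fin n → ℝ, ∫ ω in {ω | |y i - y (g ω)| < 1}, φ (g ω) ∂μ =
      (∑ j ∈ Finset.univ.filter (fun j => |y i - y j| < 1), φ j) / n := by
    intro φ
    rw [← integral_indicator hm, Finset.sum_filter, ← integral_comp_of_equipartition hg hgn]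
    rfl
  have hD := key fun _ => 1
  rw [setIntegral_const, smul_eq_mul, mul_one, Finset.sum_const, nsmul_eq_mul, mul_one] at hD
  rw [dKrauseUpdate, localMean, key y, hD, div_div_div_cancel_right₀ hn]

theorem dKrauseUpdate_mem_Icc {n : ℕ} {y : Fin n → ℝ} {L : ℝ}
    (hy : ∀ i, y i ∈ Set.Icc 0 L) (i : Fin n) : dKrauseUpdate y i ∈ Set.Icc 0 L := by
  have hpos : (0 : ℝ) < (Finset.univ.filter (fun j => |y i - y j| < 1)).card := by
    exact_mod_cast Finset.card_pos.2 ⟨i, by simp⟩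
  constructor
  · exact div_nonneg (Finset.sum_nonneg fun j _ => (hy j).1) hpos.le
  · rw [dKrauseUpdate, div_le_iff₀ hpos, mul_comm, ← nsmul_eq_mul]
    exact Finset.sum_le_card_nsmul _ _ _ fun j _ => (hy j).2

theorem iterate_dKrauseUpdate_mem_Icc {n : ℕ} {y : Fin n → ℝ} {L : ℝ}
    (hy : ∀ i, y i ∈ Set.Icc 0 L) (t : ℕ) (i : Fin n) :
    dKrauseUpdate^[t] y i ∈ Set.Icc 0 L := by
  induction t generalizing i with
  | zero => exact hy i
  | succ t ih =>
    rw [Function.iterate_succ_apply']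
    exact dKrauseUpdate_mem_Icc ih i

/-- While the spread exceeds two, the trajectory stays regular, and its distance to the
trajectory of an equipartitioned discretization is controlled by the initial distance. -/
theorem exists_isRegularOn_and_error_bound {L : ℝ} (hL : 0 ≤ L) {X : ℕ → Ω → ℝ}
    (hX : ∀ t, Measurable (X t)) (hmem : ∀ t ω, X t ω ∈ Set.Icc 0 L)
    (hstep : ∀ t ω, μ.real {ω' | |X t ω - X t ω'| < 1} ≠ 0 →
      X (t + 1) ω = localMean μ (X t) (X t ω))
    (hreg : ∃ A B m M, IsRegularOn μ (X 0) A B m M) {T : ℕ}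
    (hspread : ∀ t ≤ T, ∀ A B, (∀ ω, X t ω ∈ Set.Icc A B) → 2 < B - A) {t : ℕ} (ht : t ≤ T) :
    (∃ A B m M, IsRegularOn μ (X t) A B m M) ∧
    ∃ C, 0 ≤ C ∧ ∀ (n : ℕ) (g : Ω → Fin n) (y : Fin n → ℝ) (δ : ℝ), Measurable g →
      (∀ i, μ.real (g ⁻¹' {i}) = 1 / n) → (∀ i, y i ∈ Set.Icc 0 L) → 0 ≤ δ →
      (∀ ω, |X 0 ω - y (g ω)| ≤ δ) → ∀ ω, |X t ω - dKrauseUpdate^[t] y (g ω)| ≤ C * δ := by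
  induction t with
  | zero => exact ⟨hreg, 1, zero_le_one, fun n g y δ _ _ _ _ h ω => by simpa using h ω⟩
  | succ t ih =>
    obtain ⟨⟨A, B, m, M, h⟩, C, hC, hbound⟩ := ih (by omega)
    have hAB := hspread t (by omega) A B h.mem
    have hm := h.pos
    have hM := h.nonneg
    have hnbhd := fun ω => h.le_measureReal_neighborhood hAB (h.mem ω)
    have hstep' : ∀ ω, X (t + 1) ω = localMean μ (X t) (X t ω) := fun ω =>
      hstep t ω ((half_pos hm).trans_le (hnbhd ω)).ne'
    have habs : ∀ a ∈ Set.Icc 0 L, |a| ≤ L := fun a ha => by rw [abs_of_nonneg ha.1]; exact ha.2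
    refine ⟨h.exists_isRegularOn_of_eq_localMean hAB (hX _) hstep',
      (1 + 16 * L * M) / (m / 2) * C, by positivity, fun n g y δ hg hgn hy hδ h0 ω => ?_⟩
    have hδt := hbound n g y δ hg hgn hy hδ h0
    rw [hstep', Function.iterate_succ_apply', dKrauseUpdate_eq_localMean hg hgn, mul_assoc]
    exact abs_localMean_sub_localMean_le (hX t) ((measurable_of_finite _).comp hg) hL
      (half_pos hm) (mul_nonneg hC hδ) (fun ω' => habs _ (hmem t ω'))
      (fun ω' => habs _ (iterate_dKrauseUpdate_mem_Icc hy t _)) hδt (hδt ω)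
      h.measureReal_Icc_le (hnbhd ω)

/-- Over a finite horizon on which the spread exceeds two, equipartitioned discretizations
approximate the trajectory arbitrarily well. -/
theorem exists_equipartition_error_le {L : ℝ} (hL : 0 ≤ L) {X : ℕ → Ω → ℝ}
    (hX : ∀ t, Measurable (X t)) (hmem : ∀ t ω, X t ω ∈ Set.Icc 0 L)
    (hstep : ∀ t ω, μ.real {ω' | |X t ω - X t ω'| < 1} ≠ 0 →
      X (t + 1) ω = localMean μ (X t) (X t ω))
    (hreg : ∃ A B m M, IsRegularOn μ (X 0) A B m M) {T : ℕ}
    (hspread : ∀ t ≤ T, ∀ A B, (∀ ω, X t ω ∈ Set.Icc A B) → 2 < B - A) {ε : ℝ} (hε : 0 < ε) :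
    ∃ (n : ℕ) (g : Ω → Fin n) (y : Fin n → ℝ), Measurable g ∧ (∀ i, y i ∈ Set.Icc 0 L) ∧
      ∀ t ≤ T, ∀ ω, |X t ω - dKrauseUpdate^[t] y (g ω)| ≤ ε := by
  have hC : ∀ t, ∃ C, 0 ≤ C ∧ (t ≤ T → ∀ (n : ℕ) (g : Ω → Fin n) (y : Fin n → ℝ) (δ : ℝ),
      Measurable g → (∀ i, μ.real (g ⁻¹' {i}) = 1 / n) → (∀ i, y i ∈ Set.Icc 0 L) → 0 ≤ δ →
      (∀ ω, |X 0 ω - y (g ω)| ≤ δ) →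
      ∀ ω, |X t ω - dKrauseUpdate^[t] y (g ω)| ≤ C * δ) := by
    intro t
    by_cases ht : t ≤ T
    · obtain ⟨-, C, hC, hb⟩ :=
        exists_isRegularOn_and_error_bound hL hX hmem hstep hreg hspread ht
      exact ⟨C, hC, fun _ => hb⟩
    · exact ⟨0, le_rfl, fun h => absurd h ht⟩
  choose C hC0 hC using hC
  obtain ⟨A, B, m, M, h⟩ := hreg
  have hm := h.pos
  have hAB := hspread 0 (Nat.zero_le _) A B h.mem
  set K := ∑ t ∈ Finset.range (T + 1), C t
  have hK : ∀ t ≤ T, C t ≤ K := fun t ht =>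
    Finset.single_le_sum (fun s _ => hC0 s) (Finset.mem_range.2 (by omega))
  obtain ⟨n, hn⟩ := exists_nat_ge (K / (ε * m))
  have hn1 : (0 : ℝ) < (n + 1 : ℕ) := by positivity
  obtain ⟨g, hg, hgn, hgu⟩ := h.exists_equipartition (by linarith) n.succ_pos
  have hne : ∀ i, ∃ ω, g ω = i := by
    intro i
    by_contra! hno
    have h1 : g ⁻¹' {i} = ∅ := Set.eq_empty_of_forall_notMem hno
    have h2 := hgn i
    rw [h1, measureReal_empty] at h2
    exact (one_div_pos.2 hn1).ne h2
  choose s hs using hne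
  refine ⟨n + 1, g, fun i => X 0 (s i), hg, fun i => hmem 0 _, fun t ht ω => ?_⟩
  refine (hC t ht (n + 1) g _ (1 / ((n + 1 : ℕ) * m)) hg hgn (fun i => hmem 0 _) (by positivity)
    (fun ω' => hgu _ _ (hs _).symm) ω).trans ?_
  rw [mul_one_div, div_le_iff₀ (by positivity)]
  rw [div_le_iff₀ (by positivity)] at hn
  have h3 := hK t ht
  push_cast
  nlinarith [mul_pos hε hm]

end Discretization

theorem unitInterval.volume_real_setOf (P : ℝ → Prop) :
    (volume {α ∈ Set.Icc (0 : ℝ) 1 | P α}).toReal =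
      (volume : Measure unitInterval).real {ω | P ω} := by
  rw [Measure.real, unitInterval.volume_apply]
  congr 2
  ext α
  simp [unitInterval, and_comm]

theorem unitInterval.setIntegral_setOf (P : ℝ → Prop) (f : ℝ → ℝ)
    (hP : MeasurableSet {α | P α}) :
    ∫ α in {α ∈ Set.Icc (0 : ℝ) 1 | P α}, f α =
      ∫ ω in {ω : unitInterval | P ω}, f ω := by
  have h := unitInterval.measurePreserving_coe.setIntegral_preimage_emb
    unitInterval.measurableEmbedding_coe f {α | P α}
  rw [Measure.restrict_restrict hP, Set.inter_comm] at h
  exact h.symm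

/-- Over a finite time horizon `t*` during which the opinion
spread stays above 2, a trajectory of the continuous-agent Krause model
starting from a regular function can be approximated, uniformly within `ε`,
by a trajectory of the `n`-agent discrete Krause model: the step function `G(x̂_t)`
(equal to the `i`-th component of `x̂_t` on the partition piece `J_i`) stays
within `ε` of `x_t` for `t = 1, …, t*`. -/
theorem discrete_approximates_continuum (L : ℝ) (hL : 0 < L) (x : ℕ → ℝ → ℝ)
    (htraj : IsKrauseTraj L x) (hreg : RegularOpinion (x 0)) (tstar : ℕ)
    (hspread : ∀ t ≤ tstar,
      2 < sSup (x t '' Set.Icc (0 : ℝ) 1) - sInf (x t '' Set.Icc (0 : ℝ) 1))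
    (ε : ℝ) (hε : 0 < ε) :
    ∃ (n : ℕ) (J : Fin n → Set ℝ) (x0 : Fin n → ℝ),
      (∀ i, MeasurableSet (J i)) ∧
      Pairwise (Function.onFun Disjoint J) ∧
      (⋃ i, J i) = Set.Icc (0 : ℝ) 1 ∧
      (∀ i, x0 i ∈ Set.Icc (0 : ℝ) L) ∧
      ∀ t : ℕ, 1 ≤ t → t ≤ tstar → ∀ i : Fin n, ∀ α ∈ J i,
        |x t α - (dKrauseUpdate^[t] x0) i| ≤ ε := by
  set X : ℕ → unitInterval → ℝ := fun t ω => x t ω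
  obtain ⟨hmeas, hmem, hstep⟩ := htraj
  have hXm : ∀ t, Measurable (X t) := fun t => (hmeas t).comp measurable_subtype_coe
  have hXmem : ∀ t ω, X t ω ∈ Set.Icc 0 L := fun t ω => hmem t ω ω.2
  have hne : ∀ t, (x t '' Set.Icc (0 : ℝ) 1).Nonempty := fun t =>
    ⟨_, Set.mem_image_of_mem _ (Set.left_mem_Icc.2 zero_le_one)⟩
  have hXstep : ∀ t ω, volume.real {ω' | |X t ω - X t ω'| < 1} ≠ 0 →
      X (t + 1) ω = localMean volume (X t) (X t ω) := by
    intro t ω h0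
    have hvol := unitInterval.volume_real_setOf fun β => |x t ω - x t β| < 1
    have hintegral := unitInterval.setIntegral_setOf (fun β => |x t ω - x t β| < 1) (x t)
      (measurableSet_abs_sub_lt (hmeas t) _ _)
    have h1 : volume {β ∈ Set.Icc (0 : ℝ) 1 | |x t ω - x t β| < 1} ≠ 0 := by
      intro h
      rw [h, ENNReal.toReal_zero] at hvol
      exact h0 hvol.symm
    have h2 := hstep t ω ω.2
    rw [if_neg h1, hvol, hintegral] at h2
    exact h2
  have hXreg : ∃ A B m M, IsRegularOn volume (X 0) A B m M := by
    obtain ⟨m, M, hm, hmM, h⟩ := hreg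
    have hsub : x 0 '' Set.Icc (0 : ℝ) 1 ⊆ Set.Icc 0 L := Set.image_subset_iff.2 (hmem 0)
    have hvol := fun a b => unitInterval.volume_real_setOf fun α => x 0 α ∈ Set.Icc a b
    refine ⟨_, _, m, M, hXm 0, hm, hm.le.trans hmM, fun ω => ⟨?_, ?_⟩,
      fun a b ha hab hb => (h a b ha hab hb).1.trans_eq (hvol a b),
      fun a b ha hab hb => (hvol a b).ge.trans (h a b ha hab hb).2⟩
    · exact csInf_le (bddBelow_Icc.mono hsub) (Set.mem_image_of_mem _ ω.2)
    · exact le_csSup (bddAbove_Icc.mono hsub) (Set.mem_image_of_mem _ ω.2)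
  have hXspread : ∀ t ≤ tstar, ∀ A B, (∀ ω, X t ω ∈ Set.Icc A B) → 2 < B - A := by
    intro t ht A B hAB
    have h1 : sSup (x t '' Set.Icc (0 : ℝ) 1) ≤ B :=
      csSup_le (hne t) (Set.forall_mem_image.2 fun α hα => (hAB ⟨α, hα⟩).2)
    have h2 : A ≤ sInf (x t '' Set.Icc (0 : ℝ) 1) :=
      le_csInf (hne t) (Set.forall_mem_image.2 fun α hα => (hAB ⟨α, hα⟩).1)
    linarith [hspread t ht]
  obtain ⟨n, g, y, hg, hy, hgy⟩ :=
    exists_equipartition_error_le hL.le hXm hXmem hXstep hXreg hXspread hε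
  refine ⟨n, fun i => Subtype.val '' (g ⁻¹' {i}), y, fun i => ?_, fun i j hij => ?_, ?_, hy, ?_⟩
  · exact unitInterval.measurableEmbedding_coe.measurableSet_image.2
      (hg (measurableSet_singleton i))
  · refine (Set.disjoint_image_iff Subtype.val_injective).2 ?_
    exact Disjoint.preimage g (Set.disjoint_singleton.2 hij)
  · rw [← Set.image_iUnion, ← Set.preimage_iUnion, Set.iUnion_of_singleton, Set.preimage_univ,
      Set.image_univ, Subtype.range_coe]
  · rintro t - ht i _ ⟨ω, rfl, rfl⟩
    exact hgy t ht ω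
end
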